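/- Let (Ω, ℱ, P) be a probability space with a filtration (ℱ_t)_{t∈[0,1]} and let B : Ω × [0,1] → ℝ^d be an (ℱ_t)-Brownian motion. Let α ∈ [0,1], let b : ℝ^d → ℝ be bounded and measurable with ‖b‖_{C^α} < ∞, let p ≥ 2 and ε ∈ (0,1/2). Then there exists a constant N = N(p, d, α, ε) such that for all n ∈ ℕ and all 0 ≤ s ≤ t ≤ 1, ‖∫_s^t (b(B_r) − b(B_{κ_n(r)})) dr‖_{L_p(Ω)} ≤ N·‖b‖_{C^α}·n^{−1/2−α/2+ε}·|t−s|^{1/2+ε}. -/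

import Mathlib

open MeasureTheory ProbabilityTheory Set

/-- The `L_p(Ω)` norm `(E|X|^p)^{1/p}` of a random variable. -/
noncomputable def lpNorm {Ω : Type} [MeasurableSpace Ω] {F : Type*} [NormedAddCommGroup F]
    (P : Measure Ω) (p : ℝ) (X : Ω → F) : ℝ :=
  (∫ ω, ‖X ω‖ ^ p ∂P) ^ (1 / p)

/-- `κ_n(t) = ⌊nt⌋/n`. -/
noncomputable def kappa (n : ℕ) (t : ℝ) : ℝ := (⌊(n : ℝ) * t⌋ : ℝ) / n

/-- A `d`-dimensional `(ℱ_t)`-Brownian motion on `[0,1]`: continuous paths,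
`B_0 = 0`, adapted, and for `0 ≤ s ≤ t ≤ 1` the increment `B_t - B_s` is
independent of `ℱ_s` and is a centered Gaussian vector with covariance
`(t-s)·I_d` (i.e. its coordinates are i.i.d. `N(0, t-s)`). -/
structure IsBrownianMotion {Ω : Type} [MeasurableSpace Ω] (P : Measure Ω)
    (ℱ : ℝ → MeasurableSpace Ω) {d : ℕ}
    (B : ℝ → Ω → EuclideanSpace ℝ (Fin d)) : Prop where
  contPaths : ∀ ω, ContinuousOn (fun t => B t ω) (Icc 0 1)
  init : ∀ ω, B 0 ω = 0
  adapted : ∀ t : ℝ, 0 ≤ t → t ≤ 1 → Measurable[ℱ t] (B t)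
  indep : ∀ s t : ℝ, 0 ≤ s → s ≤ t → t ≤ 1 →
    ProbabilityTheory.Indep
      (MeasurableSpace.comap (fun ω => fun i => B t ω i - B s ω i) inferInstance)
      (ℱ s) P
  law : ∀ s t : ℝ, 0 ≤ s → s ≤ t → t ≤ 1 →
    Measure.map (fun ω => fun i => B t ω i - B s ω i) P
      = Measure.pi (fun _ : Fin d => gaussianReal 0 (Real.toNNReal (t - s)))



abbrev EE (d : ℕ) := EuclideanSpace ℝ (Fin d)

noncomputable def gam (d : ℕ) : Measure (EE d) := stdGaussian (EE d)

instance gam_prob (d : ℕ) : IsProbabilityMeasure (gam d) := by unfold gam; infer_instance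

lemma charFun_gam (d : ℕ) (t : EE d) : charFun (gam d) t = Complex.exp (-‖t‖ ^ 2 / 2) :=
  charFun_stdGaussian t

noncomputable def gDens (d : ℕ) (x : EE d) : ℝ :=
  (2 * Real.pi) ^ (-(d : ℝ) / 2) * Real.exp (-(1/2) * ‖x‖ ^ 2)

lemma gDens_nonneg (d : ℕ) (x : EE d) : 0 ≤ gDens d x := by
  unfold gDens; positivity

lemma integrable_exp_norm (d : ℕ) (c : ℝ) (hc : 0 < c) :
    Integrable (fun x : EE d => Real.exp (-c * ‖x‖ ^ 2)) := by
  have h := (GaussianFourier.integrable_cexp_neg_mul_sq_norm_add (V := EE d) (b := (c : ℂ)) (by simpa using hc) 0 0).norm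
  refine h.congr (Filter.Eventually.of_forall fun x => ?_)
  simp only [zero_mul, add_zero, Complex.norm_exp]
  congr 1
  norm_cast

lemma integrable_gDens (d : ℕ) : Integrable (gDens d) := by
  unfold gDens
  exact (integrable_exp_norm d (1/2) (by norm_num)).const_mul _

lemma gam_eq (d : ℕ) :
    gam d = (volume : Measure (EE d)).withDensity (fun x => ENNReal.ofReal (gDens d x)) := by
  have : IsFiniteMeasure ((volume : Measure (EE d)).withDensity (fun x => ENNReal.ofReal (gDens d x))) :=
    isFiniteMeasure_withDensity_ofReal (integrable_gDens d).2
  have hm : Measurable (gDens d) := by unfold gDens; fun_prop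
  apply Measure.ext_of_charFun
  ext t
  rw [charFun_gam, charFun_apply]
  rw [integral_withDensity_eq_integral_toReal_smul (by fun_prop) (by simp)]
  have h := GaussianFourier.integral_cexp_neg_mul_sq_norm_add (V := EE d) (b := ((1/2 : ℝ) : ℂ)) (by norm_num) Complex.I t
  have h2 : ∀ x : EE d, (ENNReal.ofReal (gDens d x)).toReal • Complex.exp ((inner ℝ x t : ℝ) * Complex.I)
      = (((2 * Real.pi) ^ (-(d : ℝ) / 2) : ℝ) : ℂ) * Complex.exp (-((1/2 : ℝ) : ℂ) * ‖x‖ ^ 2 + Complex.I * (inner ℝ t x : ℝ)) := by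
    intro x
    rw [ENNReal.toReal_ofReal (gDens_nonneg d x), gDens, real_inner_comm, Complex.exp_add]
    simp only [Complex.real_smul]
    push_cast
    ring_nf
  simp_rw [h2]
  rw [integral_const_mul, h]
  have h3 : ((Real.pi : ℂ) / ((1/2 : ℝ) : ℂ)) = ((2 * Real.pi : ℝ) : ℂ) := by push_cast; field_simp
  have h4 : ((2 * Real.pi : ℝ) : ℂ) ^ ((Module.finrank ℝ (EE d) : ℂ) / 2) = (((2 * Real.pi) ^ ((d : ℝ) / 2) : ℝ) : ℂ) := by
    rw [Complex.ofReal_cpow (by positivity)]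
    simp
  rw [h3, h4, ← mul_assoc, ← Complex.ofReal_mul, ← Real.rpow_add (by positivity)]
  have : -(d : ℝ) / 2 + d / 2 = 0 := by ring
  rw [this]
  simp
  congr 1
  ring

lemma integral_gam (d : ℕ) (f : EE d → ℝ) :
    ∫ x, f x ∂(gam d) = ∫ x, gDens d x * f x := by
  have hm : Measurable (gDens d) := by unfold gDens; fun_prop
  rw [gam_eq, integral_withDensity_eq_integral_toReal_smul (by fun_prop) (by simp)]
  simp [ENNReal.toReal_ofReal (gDens_nonneg d _)]

lemma charFun_gam_smul (d : ℕ) (v : ℝ) (hv : 0 ≤ v) (t : EE d) :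
    charFun ((gam d).map (fun z => (√v) • z)) t = Complex.exp (((-(v * ‖t‖ ^ 2 / 2) : ℝ)) : ℂ) := by
  rw [charFun_map_smul, charFun_gam, norm_smul, Real.norm_eq_abs, abs_of_nonneg (Real.sqrt_nonneg _)]
  rw [← Complex.ofReal_pow, mul_pow, Real.sq_sqrt hv]
  congr 1
  push_cast
  ring

lemma law_pi (d : ℕ) (v : ℝ) (hv : 0 ≤ v) :
    (Measure.pi (fun _ : Fin d => gaussianReal 0 (Real.toNNReal v))).map (WithLp.toLp 2)
      = (gam d).map (fun z => (√v) • z) := by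
  apply Measure.ext_of_charFun (E := EE d)
  ext t
  rw [charFun_gam_smul d v hv, charFun_pi]
  simp_rw [charFun_gaussianReal, ← Complex.exp_sum]
  congr 1
  rw [EuclideanSpace.real_norm_sq_eq, Real.coe_toNNReal v hv]
  push_cast
  rw [Finset.mul_sum, Finset.sum_div, ← Finset.sum_neg_distrib]
  simp

lemma gam_conv (d : ℕ) (a c : ℝ) (ha : 0 ≤ a) (hc : 0 ≤ c) :
    ((gam d).prod (gam d)).map (fun z => √a • z.1 + √c • z.2) = (gam d).map (fun z => √(a+c) • z) := by
  have h : ((gam d).prod (gam d)).map (fun z => √a • z.1 + √c • z.2)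
     = ((((gam d).map (fun z => √a • z))).prod ((gam d).map (fun z => √c • z))).map (fun z => z.1 + z.2) := by
    rw [Measure.map_prod_map _ _ (by fun_prop) (by fun_prop), Measure.map_map (by fun_prop) (by fun_prop)]
    rfl
  have p1 : IsProbabilityMeasure ((gam d).map (fun z => √a • z)) :=
    Measure.isProbabilityMeasure_map (by fun_prop)
  have p2 : IsProbabilityMeasure ((gam d).map (fun z => √c • z)) :=
    Measure.isProbabilityMeasure_map (by fun_prop)
  rw [h]
  apply Measure.ext_of_charFun
  ext t
  rw [charFun_map_add_prod_eq_mul, Pi.mul_apply]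
  rw [charFun_gam_smul d a ha, charFun_gam_smul d c hc, charFun_gam_smul d _ (add_nonneg ha hc), ← Complex.exp_add]
  congr 1
  push_cast
  ring


lemma int_poly (d : ℕ) : Integrable (fun x : EE d => (1 + ‖x‖) ^ 3 * Real.exp (-(1/4) * ‖x‖ ^ 2)) := by
  refine Integrable.mono' ((integrable_exp_norm d (1/8) (by norm_num)).const_mul (48 ^ 3)) (by fun_prop) ?_
  refine Filter.Eventually.of_forall fun x => ?_
  rw [Real.norm_of_nonneg (by positivity)]
  have h1 : (1 + ‖x‖) ≤ 48 * Real.exp (‖x‖ ^ 2 / 24) := by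
    have := Real.add_one_le_exp (‖x‖ ^ 2 / 24)
    nlinarith [sq_nonneg (‖x‖ - 1), norm_nonneg x]
  have h2 : (1 + ‖x‖) ^ 3 ≤ (48 * Real.exp (‖x‖ ^ 2 / 24)) ^ 3 := by
    gcongr
  calc _ ≤ (48 * Real.exp (‖x‖ ^ 2 / 24)) ^ 3 * Real.exp (-(1/4) * ‖x‖ ^ 2) := by gcongr
    _ = _ := by
      rw [mul_pow, ← Real.exp_nat_mul, mul_assoc, ← Real.exp_add]
      congr 2
      push_cast
      ring

lemma gam_memLp_id (d l : ℕ): MemLp (fun z : EE d => z) (l : ENNReal) (gam d) := by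
    unfold gam
    exact IsGaussian.memLp_id (stdGaussian (EE d)) (l : ENNReal) (by simp)
lemma gam_memLp_one (d l : ℕ) : MemLp (fun z : EE d => 1 + ‖z‖) (l : ENNReal) (gam d) := by
  have h2 : MemLp (fun z : EE d => ‖z‖) (l : ENNReal) (gam d) := (gam_memLp_id d l).norm
  have h3 : MemLp (fun z : EE d => (1:ℝ)) (l : ENNReal) (gam d) := memLp_const 1
  exact h3.add h2
lemma gam_moment (d : ℕ) (l : ℕ) : Integrable (fun z : EE d => (1 + ‖z‖) ^ l) (gam d) := by
  have h2 := (gam_memLp_one d l).integrable_norm_pow'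
  have h3 : (fun z : EE d => ‖1 + ‖z‖‖ ^ l) = fun z : EE d => (1 + ‖z‖) ^ l := by
    funext z
    rw [Real.norm_of_nonneg]
    have := norm_nonneg z
    linarith
  rw [h3] at h2
  exact h2

lemma exp_diff_scale (x q u D : ℝ) (hx : 0 ≤ x) (hq0 : 0 ≤ q) (hq1 : q ≤ 1) (hu1 : u ≤ 1)
    (hu0 : 1 - D * q ≤ u) (hD : 0 ≤ D) :
    |u * Real.exp (-(1/2) * (x / (1 + q))) - Real.exp (-(1/2) * x)|
      ≤ q * ((D + x) * Real.exp (-(1/4) * x)) := by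
  have e1 : Real.exp (-(1/2) * (x / (1 + q))) ≤ Real.exp (-(1/4) * x) := by
    apply Real.exp_le_exp.2
    have : x / 2 ≤ x / (1 + q) := by gcongr; linarith
    linarith
  have e2 : Real.exp (-(1/2) * x) = Real.exp (-(1/2) * (x / (1 + q))) * Real.exp (-((1/2) * (x * q / (1+q)))) := by
    rw [← Real.exp_add]; congr 1; field_simp; ring
  have e3 := Real.one_sub_le_exp_neg ((1/2) * (x * q / (1+q)))
  have e4 : Real.exp (-((1/2) * (x * q / (1+q)))) ≤ 1 := by
    apply Real.exp_le_one_iff.2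
    have : 0 ≤ x * q / (1 + q) := by positivity
    linarith
  have e5 : x * q / (1 + q) ≤ x * q := div_le_self (by positivity) (by linarith)
  have e6 : 0 ≤ x * q := by positivity
  rw [e2]
  set a := Real.exp (-(1/2) * (x / (1 + q))) with ha
  set w := Real.exp (-((1/2) * (x * q / (1+q)))) with hw
  have ha0 : 0 < a := Real.exp_pos _
  have e7 : |u - w| ≤ q * (D + x) := by
    rw [abs_le]; constructor <;> nlinarith
  calc |u * a - a * w| = |u - w| * a := by
        rw [← abs_of_pos ha0, ← abs_mul, abs_of_pos ha0]; ring_nf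
    _ ≤ q * (D + x) * Real.exp (-(1/4) * x) := by gcongr
    _ = _ := by ring

lemma exp_diff_shift (a b : ℝ) : |Real.exp (-a) - Real.exp (-b)| ≤ |a - b| * (Real.exp (-a) + Real.exp (-b)) := by
  wlog h : a ≤ b generalizing a b
  · have := this b a (le_of_not_ge h)
    rw [abs_sub_comm, abs_sub_comm a b, add_comm]; exact this
  have e1 : Real.exp (-b) = Real.exp (-a) * Real.exp (-(b - a)) := by rw [← Real.exp_add]; congr 1; ring
  have e2 := Real.one_sub_le_exp_neg (b - a)
  have e3 : Real.exp (-b) ≤ Real.exp (-a) := Real.exp_le_exp.2 (by linarith)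
  rw [abs_of_nonneg (by linarith), abs_of_nonpos (by linarith)]
  have := Real.exp_pos (-a)
  have := Real.exp_pos (-b)
  nlinarith

lemma gauss_scale (d : ℕ) : ∃ C : ℝ, 0 < C ∧ ∀ f : EE d → ℝ, Measurable f → ∀ A : ℝ, 0 ≤ A →
    (∀ z, |f z| ≤ A * (1 + ‖z‖)) → ∀ q : ℝ, 0 ≤ q → q ≤ 1 →
    |∫ z, f (√(1 + q) • z) ∂(gam d) - ∫ z, f z ∂(gam d)| ≤ C * A * q := by
  set c0 : ℝ := (2 * Real.pi) ^ (-(d : ℝ) / 2) with hc0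
  have hc0p : 0 < c0 := by positivity
  set J : ℝ := ∫ x : EE d, (1 + ‖x‖) ^ 3 * Real.exp (-(1/4) * ‖x‖ ^ 2) with hJ
  have hJ0 : 0 ≤ J := integral_nonneg fun x => by positivity
  refine ⟨c0 * (d + 1) * J + 1, by positivity, ?_⟩
  intro f hf A hA hfA q hq0 hq1
  set L := √(1 + q) with hL
  have hLsq : L ^ 2 = 1 + q := Real.sq_sqrt (by linarith)
  have hLpos : 0 < L := Real.sqrt_pos.2 (by linarith)
  have hL1 : 1 ≤ L := by nlinarith
  set u : ℝ := (L ^ d)⁻¹ with hu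
  have hu1 : u ≤ 1 := inv_le_one_of_one_le₀ (one_le_pow₀ hL1)
  have hu0 : 1 - (d : ℝ) * q ≤ u := by
    have h1 := one_add_mul_le_pow (a := -q) (by linarith) d
    have h2 : (1 + -q) ≤ L⁻¹ := by
      rw [← one_div, le_div_iff₀ hLpos]
      nlinarith
    have h3 : (1 + -q) ^ d ≤ L⁻¹ ^ d := pow_le_pow_left₀ (by linarith) h2 d
    rw [hu, ← inv_pow]
    linarith
  have hup : 0 < u := by positivity
  have key : ∫ z, f (L • z) ∂(gam d) = ∫ y : EE d, (u * gDens d (L⁻¹ • y)) * f y := by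
    rw [integral_gam]
    have := Measure.integral_comp_smul (volume : Measure (EE d)) (fun y => gDens d (L⁻¹ • y) * f y) L
    simp only [smul_smul, inv_mul_cancel₀ hLpos.ne', one_smul] at this
    rw [this]
    have hfin : Module.finrank ℝ (EE d) = d := by simp
    rw [hfin, abs_of_pos (by positivity), smul_eq_mul, ← integral_const_mul]
    congr 1; ext y; rw [hu]; ring
  have hm : Measurable (gDens d) := by unfold gDens; fun_prop
  have gd : ∀ y : EE d, gDens d (L⁻¹ • y) = c0 * Real.exp (-(1/2) * (‖y‖ ^ 2 / (1 + q))) := by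
    intro y
    rw [gDens, norm_smul, mul_pow, norm_inv, Real.norm_of_nonneg hLpos.le, inv_pow, hLsq]
    congr 2; ring
  have ex4 : ∀ y : EE d, Real.exp (-(1/2) * (‖y‖ ^ 2 / (1 + q))) ≤ Real.exp (-(1/4) * ‖y‖ ^ 2) := by
    intro y
    apply Real.exp_le_exp.2
    have : ‖y‖ ^ 2 / 2 ≤ ‖y‖ ^ 2 / (1 + q) := by gcongr; linarith
    linarith
  have dom : ∀ y : EE d, A * (1 + ‖y‖) ≤ A * (1 + ‖y‖) ^ 3 := by
    intro y
    gcongr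
    exact le_self_pow₀ (by linarith [norm_nonneg y]) (by norm_num)
  have i1 : Integrable (fun y : EE d => (u * gDens d (L⁻¹ • y)) * f y) := by
    refine Integrable.mono' ((int_poly d).const_mul (c0 * A)) (by fun_prop) (Filter.Eventually.of_forall fun y => ?_)
    rw [gd, norm_mul, Real.norm_of_nonneg (by positivity)]
    calc _ ≤ (1 * (c0 * Real.exp (-(1/4) * ‖y‖ ^ 2))) * (A * (1 + ‖y‖) ^ 3) := by
          refine mul_le_mul (mul_le_mul hu1 (mul_le_mul_of_nonneg_left (ex4 y) hc0p.le) (by positivity) (by norm_num)) ((hfA y).trans (dom y)) (abs_nonneg _) (by positivity)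
      _ = _ := by ring
  have i2 : Integrable (fun y : EE d => gDens d y * f y) := by
    refine Integrable.mono' ((int_poly d).const_mul (c0 * A)) (by fun_prop) (Filter.Eventually.of_forall fun y => ?_)
    rw [gDens, norm_mul, Real.norm_of_nonneg (by positivity)]
    calc _ ≤ ((c0 * Real.exp (-(1/4) * ‖y‖ ^ 2))) * (A * (1 + ‖y‖) ^ 3) := by
          gcongr
          · nlinarith [sq_nonneg ‖y‖]
          · exact (hfA y).trans (dom y)
      _ = _ := by ring
  rw [key, integral_gam, ← integral_sub i1 i2, ← Real.norm_eq_abs]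
  have := norm_integral_le_of_norm_le (f := fun y : EE d => u * gDens d (L⁻¹ • y) * f y - gDens d y * f y)
    ((int_poly d).const_mul (c0 * (d + 1) * A * q)) (Filter.Eventually.of_forall fun y => by
      rw [gd, gDens, ← hc0, Real.norm_eq_abs]
      have h := exp_diff_scale (‖y‖ ^ 2) q u d (by positivity) hq0 hq1 hu1 hu0 (by positivity)
      calc _ = c0 * |u * Real.exp (-(1/2) * (‖y‖ ^ 2 / (1 + q))) - Real.exp (-(1/2) * ‖y‖ ^ 2)| * |f y| := by
            rw [← abs_of_pos hc0p, ← abs_mul, ← abs_mul, abs_of_pos hc0p]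
            congr 1; ring
        _ ≤ c0 * (q * ((d + ‖y‖ ^ 2) * Real.exp (-(1/4) * ‖y‖ ^ 2))) * (A * (1 + ‖y‖)) := by
            gcongr; exact hfA y
        _ = c0 * A * q * Real.exp (-(1/4) * ‖y‖ ^ 2) * ((d + ‖y‖ ^ 2) * (1 + ‖y‖)) := by ring
        _ ≤ c0 * A * q * Real.exp (-(1/4) * ‖y‖ ^ 2) * ((d + 1) * (1 + ‖y‖) ^ 3) := by
            gcongr ?_ * ?_
            have hy := norm_nonneg y
            have hd : (0:ℝ) ≤ d := by positivity
            nlinarith [mul_nonneg hd hy, mul_nonneg hy hy, mul_nonneg hd (mul_nonneg hy hy), mul_nonneg hy (mul_nonneg hy hy), mul_nonneg hd (mul_nonneg hy (mul_nonneg hy hy))]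
        _ = _ := by ring)
  rw [integral_const_mul] at this
  refine this.trans ?_
  rw [← hJ]
  nlinarith [mul_nonneg hA hq0]

lemma gauss_shift (d : ℕ) : ∃ C : ℝ, 0 < C ∧ ∀ f : EE d → ℝ, Measurable f → ∀ A : ℝ, 0 ≤ A →
    (∀ z, |f z| ≤ A) → ∀ v : EE d,
    |∫ z, f (z + v) ∂(gam d) - ∫ z, f z ∂(gam d)| ≤ C * A * ‖v‖ := by
  set c0 : ℝ := (2 * Real.pi) ^ (-(d : ℝ) / 2) with hc0
  have hc0p : 0 < c0 := by positivity
  set J : ℝ := ∫ x : EE d, (1 + ‖x‖) ^ 3 * Real.exp (-(1/4) * ‖x‖ ^ 2) with hJ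
  have hJ0 : 0 ≤ J := integral_nonneg fun x => by positivity
  refine ⟨c0 * 3 * J + 2, by positivity, ?_⟩
  intro f hf A hA hfA v
  by_cases hv : 1 < ‖v‖
  · have b1 : ∀ w : EE d, |∫ z, f (z + w) ∂(gam d)| ≤ A := by
      intro w
      have := norm_integral_le_of_norm_le_const (μ := gam d) (f := fun z => f (z + w)) (C := A) (Filter.Eventually.of_forall fun z => hfA _)
      rw [probReal_univ, mul_one] at this
      exact this
    have h1 := b1 v
    have h2 := b1 0
    simp only [add_zero] at h2
    generalize (∫ z, f (z + v) ∂(gam d)) = a1 at *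
    generalize (∫ z, f z ∂(gam d)) = a2 at *
    have h3 : |a1 - a2| ≤ |a1| + |a2| := by simpa using norm_sub_le a1 a2
    have hcJ : 0 ≤ c0 * 3 * J := mul_nonneg (mul_nonneg hc0p.le (by norm_num)) hJ0
    have : 0 ≤ c0 * 3 * J * A * ‖v‖ := mul_nonneg (mul_nonneg hcJ hA) (norm_nonneg v)
    nlinarith
  push Not at hv
  have key : ∫ z, f (z + v) ∂(gam d) = ∫ y : EE d, gDens d (y - v) * f y := by
    rw [integral_gam, ← integral_sub_right_eq_self _ v]
    simp
  have hm : Measurable (gDens d) := by unfold gDens; fun_prop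
  have i0 := (integrable_gDens d)
  have i1 : Integrable (fun y : EE d => gDens d (y - v) * f y) := by
    refine Integrable.mul_bdd (c := A) (i0.comp_sub_right v) (by fun_prop) (Filter.Eventually.of_forall fun y => hfA y)
  have i2 : Integrable (fun y : EE d => gDens d y * f y) := by
    refine Integrable.mul_bdd (c := A) i0 (by fun_prop) (Filter.Eventually.of_forall fun y => hfA y)
  rw [key, integral_gam, ← integral_sub i1 i2, ← Real.norm_eq_abs]
  have := norm_integral_le_of_norm_le (f := fun y : EE d => gDens d (y - v) * f y - gDens d y * f y)
    ((int_poly d).const_mul (c0 * 3 * A * ‖v‖)) (Filter.Eventually.of_forall fun y => by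
      rw [gDens, gDens, ← hc0, Real.norm_eq_abs]
      have h := exp_diff_shift ((1/2) * ‖y - v‖ ^ 2) ((1/2) * ‖y‖ ^ 2)
      have t1 : ‖y - v‖ ≤ ‖y‖ + ‖v‖ := norm_sub_le _ _
      have t2 : ‖y‖ ≤ ‖y - v‖ + ‖v‖ := by
        simpa using norm_add_le (y - v) v
      have n1 := norm_nonneg y
      have n2 := norm_nonneg v
      have n3 := norm_nonneg (y - v)
      have h1 : |(1/2) * ‖y - v‖ ^ 2 - (1/2) * ‖y‖ ^ 2| ≤ ‖v‖ * (1 + ‖y‖) := by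
        rw [abs_le]; constructor <;> nlinarith
      have h2 : Real.exp (-((1/2) * ‖y - v‖ ^ 2)) ≤ 2 * Real.exp (-(1/4) * ‖y‖ ^ 2) := by
        have e1 : Real.exp (-((1/2) * ‖y - v‖ ^ 2)) ≤ Real.exp (1/2 + (-(1/4) * ‖y‖ ^ 2)) := by
          apply Real.exp_le_exp.2
          nlinarith [sq_nonneg (‖y - v‖ - ‖v‖)]
        rw [Real.exp_add] at e1
        have e2 : Real.exp (1/2) ≤ 2 := by
          have := Real.exp_one_lt_d9
          have h3 : Real.exp (1/2) ^ 2 = Real.exp 1 := by rw [← Real.exp_nat_mul]; norm_num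
          nlinarith [Real.exp_pos (1/2)]
        refine e1.trans ?_
        gcongr
      have h3 : Real.exp (-((1/2) * ‖y‖ ^ 2)) ≤ Real.exp (-(1/4) * ‖y‖ ^ 2) := by
        apply Real.exp_le_exp.2; nlinarith
      calc _ = c0 * |Real.exp (-((1/2) * ‖y - v‖ ^ 2)) - Real.exp (-((1/2) * ‖y‖ ^ 2))| * |f y| := by
            rw [← abs_of_pos hc0p, ← abs_mul, ← abs_mul, abs_of_pos hc0p, neg_mul, neg_mul]
            congr 1; ring
        _ ≤ c0 * ((‖v‖ * (1 + ‖y‖)) * (2 * Real.exp (-(1/4) * ‖y‖ ^ 2) + Real.exp (-(1/4) * ‖y‖ ^ 2))) * A := by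
            gcongr
            · refine h.trans ?_
              gcongr
            · exact hfA y
        _ = c0 * 3 * A * ‖v‖ * ((1 + ‖y‖) * Real.exp (-(1/4) * ‖y‖ ^ 2)) := by ring
        _ ≤ _ := by
            gcongr
            exact le_self_pow₀ (by linarith) (by norm_num))
  rw [integral_const_mul] at this
  refine this.trans ?_
  rw [← hJ]
  nlinarith [mul_nonneg hA (norm_nonneg v)]


noncomputable def PT {d : ℕ} (b : EE d → ℝ) (τ : ℝ) (x : EE d) : ℝ :=
  ∫ z, b (x + √τ • z) ∂(gam d)

lemma PT_meas {d : ℕ} {b : EE d → ℝ} (hb : Measurable b) :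
    Measurable (fun p : ℝ × EE d => PT b p.1 p.2) := by
  have h : Measurable (fun q : (ℝ × EE d) × EE d => b (q.1.2 + √q.1.1 • q.2)) := by fun_prop
  exact (h.stronglyMeasurable.integral_prod_right' (ν := gam d)).measurable

lemma PT_meas1 {d : ℕ} {b : EE d → ℝ} (hb : Measurable b) (τ : ℝ) :
    Measurable (PT b τ) := (PT_meas hb).comp (measurable_const.prodMk measurable_id)

lemma PT_integrable {d : ℕ} {b : EE d → ℝ} (hb : Measurable b) {A : ℝ} (hA : ∀ x, |b x| ≤ A) (τ : ℝ) (x : EE d) :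
    Integrable (fun z => b (x + √τ • z)) (gam d) :=
  Integrable.of_bound (C := A) (show Measurable (fun z => b (x + √τ • z)) by fun_prop).aestronglyMeasurable
    (Filter.Eventually.of_forall fun z => hA _)

lemma PT_bdd {d : ℕ} {b : EE d → ℝ} {A : ℝ} (hA : ∀ x, |b x| ≤ A) (τ : ℝ) (x : EE d) :
    |PT b τ x| ≤ A := by
  have := norm_integral_le_of_norm_le_const (μ := gam d) (f := fun z => b (x + √τ • z)) (C := A)
    (Filter.Eventually.of_forall fun z => hA _)
  rw [probReal_univ, mul_one] at this
  exact this

lemma PT_zero {d : ℕ} (b : EE d → ℝ) (x : EE d) : PT b 0 x = b x := by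
  simp [PT]

lemma PT_sub {d : ℕ} {b c : EE d → ℝ} (hb : Measurable b) (hc : Measurable c) {A A' : ℝ}
    (hA : ∀ x, |b x| ≤ A) (hA' : ∀ x, |c x| ≤ A') (τ : ℝ) (x : EE d) :
    PT (fun y => b y - c y) τ x = PT b τ x - PT c τ x :=
  integral_sub (PT_integrable hb hA τ x) (PT_integrable hc hA' τ x)

lemma PT_semi {d : ℕ} {b : EE d → ℝ} (hb : Measurable b) {A : ℝ} (hA : ∀ x, |b x| ≤ A)
    (a c : ℝ) (ha : 0 ≤ a) (hc : 0 ≤ c) (x : EE d) :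
    PT (PT b a) c x = PT b (c + a) x := by
  have hmeas : Measurable (fun y => b (x + y)) := by fun_prop
  have h2 : ∫ w, b (x + w) ∂((gam d).map (fun z => √(c+a) • z)) = PT b (c + a) x := by
    rw [integral_map (by fun_prop) hmeas.aestronglyMeasurable]; rfl
  rw [← h2, ← gam_conv d c a hc ha, integral_map (by fun_prop) hmeas.aestronglyMeasurable, integral_prod]
  · unfold PT
    simp only [add_assoc]
  · exact Integrable.of_bound (C := A)
      (show Measurable (fun z : EE d × EE d => b (x + (√c • z.1 + √a • z.2))) by fun_prop).aestronglyMeasurable (Filter.Eventually.of_forall fun z => hA _)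

lemma rpow_le_one_add (s α : ℝ) (hs : 0 ≤ s) (h0 : 0 ≤ α) (h1 : α ≤ 1) : s ^ α ≤ 1 + s := by
  rcases le_total s 1 with h | h
  · have := Real.rpow_le_one hs h h0
    linarith
  · have := Real.rpow_le_rpow_of_exponent_le h h1
    rw [Real.rpow_one] at this
    linarith

lemma hold_lin {d : ℕ} (α τ : ℝ) (h0 : 0 ≤ α) (h1 : α ≤ 1) (hτ : 0 ≤ τ) (z : EE d) :
    ‖√τ • z‖ ^ α ≤ τ ^ (α / 2) * (1 + ‖z‖) := by
  rw [norm_smul, Real.mul_rpow (norm_nonneg _) (norm_nonneg _), Real.norm_of_nonneg (Real.sqrt_nonneg _),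
    Real.sqrt_eq_rpow, ← Real.rpow_mul hτ]
  have e : 1 / 2 * α = α / 2 := by ring
  rw [e]
  exact mul_le_mul_of_nonneg_left (rpow_le_one_add _ _ (norm_nonneg _) h0 h1) (Real.rpow_nonneg hτ _)

lemma PT_time (d : ℕ) : ∃ C : ℝ, 0 < C ∧ ∀ (α : ℝ), 0 ≤ α → α ≤ 1 → ∀ (b : EE d → ℝ) (A H : ℝ), Measurable b →
    (∀ x, |b x| ≤ A) → 0 ≤ H → (∀ x y, |b x - b y| ≤ H * ‖x - y‖ ^ α) → ∀ τ h : ℝ, 0 < τ → 0 ≤ h → h ≤ τ → ∀ x,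
    |PT b (τ + h) x - PT b τ x| ≤ C * (H * τ ^ (α / 2)) * (h / τ) := by
  obtain ⟨C, hC, h⟩ := gauss_scale d
  refine ⟨C, hC, ?_⟩
  intro α h0 h1 b A H hb hA hH hbH τ η hτ hη hητ x
  have hq1 : η / τ ≤ 1 := (div_le_one hτ).2 hητ
  have := h (fun z => b (x + √τ • z) - b x) (by fun_prop) (H * τ ^ (α / 2)) (by positivity)
    (by
      intro z
      have e1 := hbH (x + √τ • z) x
      rw [add_sub_cancel_left] at e1
      refine e1.trans ?_
      rw [mul_assoc]
      exact mul_le_mul_of_nonneg_left (hold_lin α τ h0 h1 hτ.le z) hH) (η / τ) (by positivity) hq1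
  have e2 : ∫ z, (b (x + √τ • √(1 + η / τ) • z) - b x) ∂(gam d) = PT b (τ + η) x - b x := by
    simp only [smul_smul]
    rw [← Real.sqrt_mul hτ.le, mul_add, mul_one, mul_div_cancel₀ _ hτ.ne',
      integral_sub (PT_integrable hb hA _ _) (integrable_const _)]
    simp [PT]
  have e3 : ∫ z, (b (x + √τ • z) - b x) ∂(gam d) = PT b τ x - b x := by
    rw [integral_sub (PT_integrable hb hA _ _) (integrable_const _)]
    simp [PT]
  rw [e2, e3, sub_sub_sub_cancel_right] at this
  exact this

lemma PT_near (d : ℕ) : ∃ C : ℝ, 0 < C ∧ ∀ (α : ℝ), 0 ≤ α → α ≤ 1 → ∀ (b : EE d → ℝ) (A H : ℝ), Measurable b →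
    (∀ x, |b x| ≤ A) → 0 ≤ H → (∀ x y, |b x - b y| ≤ H * ‖x - y‖ ^ α) → ∀ τ : ℝ, 0 ≤ τ → ∀ x,
    |PT b τ x - b x| ≤ C * (H * τ ^ (α / 2)) := by
  have hi := gam_moment d 1
  have hn : 0 ≤ ∫ z, (1 + ‖z‖) ^ 1 ∂(gam d) :=
    integral_nonneg fun z => pow_nonneg (add_nonneg zero_le_one (norm_nonneg z)) 1
  refine ⟨∫ z, (1 + ‖z‖) ^ 1 ∂(gam d) + 1, by linarith, ?_⟩
  intro α h0 h1 b A H hb hA hH hbH τ hτ x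
  have e3 : ∫ z, (b (x + √τ • z) - b x) ∂(gam d) = PT b τ x - b x := by
    rw [integral_sub (PT_integrable hb hA _ _) (integrable_const _)]
    simp [PT]
  have hP : 0 ≤ H * τ ^ (α / 2) := mul_nonneg hH (Real.rpow_nonneg hτ _)
  have := norm_integral_le_of_norm_le (f := fun z => b (x + √τ • z) - b x) (hi.const_mul (H * τ ^ (α / 2)))
    (Filter.Eventually.of_forall fun z => by
      have e1 := hbH (x + √τ • z) x
      rw [add_sub_cancel_left] at e1
      refine e1.trans ?_
      rw [mul_assoc, pow_one]
      exact mul_le_mul_of_nonneg_left (hold_lin α τ h0 h1 hτ z) hH)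
  rw [e3, integral_const_mul] at this
  refine this.trans ?_
  rw [mul_comm]
  exact mul_le_mul_of_nonneg_right (by linarith) hP

lemma PT_grad (d : ℕ) : ∃ C : ℝ, 0 < C ∧ ∀ (f : EE d → ℝ) (A : ℝ), Measurable f → 0 ≤ A →
    (∀ x, |f x| ≤ A) → ∀ τ : ℝ, 0 < τ → ∀ x y,
    |PT f τ x - PT f τ y| ≤ C * A * (‖x - y‖ / √τ) := by
  obtain ⟨C, hC, h⟩ := gauss_shift d
  refine ⟨C, hC, ?_⟩
  intro f A hf hA0 hA τ hτ x y
  have hs : 0 < √τ := Real.sqrt_pos.2 hτ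
  have := h (fun z => f (y + √τ • z)) (by fun_prop) A hA0 (fun z => hA _) ((√τ)⁻¹ • (x - y))
  have e : ∀ z : EE d, y + √τ • (z + (√τ)⁻¹ • (x - y)) = x + √τ • z := by
    intro z
    rw [smul_add, smul_smul, mul_inv_cancel₀ hs.ne', one_smul]; abel
  simp only [e] at this
  rw [norm_smul, norm_inv, Real.norm_of_nonneg hs.le, inv_mul_eq_div] at this
  exact this

noncomputable def gm {d : ℕ} (b : EE d → ℝ) (δ : ℝ) (m : ℕ) (x : EE d) : ℝ :=
  ∫ ρ in (0:ℝ)..δ, (PT b (m * δ + ρ) x - PT b (m * δ) x)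

lemma gm_meas {d : ℕ} {b : EE d → ℝ} (hb : Measurable b) (δ : ℝ) (hδ : 0 ≤ δ) (m : ℕ) : Measurable (gm b δ m) := by
  have h : Measurable (fun p : EE d × ℝ => PT b (m * δ + p.2) p.1 - PT b (m * δ) p.1) := by
    apply Measurable.sub
    · exact (PT_meas hb).comp (Measurable.prodMk (by fun_prop) measurable_fst)
    · exact (PT_meas1 hb _).comp measurable_fst
  have e : gm b δ m = fun x => ∫ ρ in Ioc 0 δ, (PT b (m * δ + ρ) x - PT b (m * δ) x) := by
    funext x; rw [gm, intervalIntegral.integral_of_le hδ]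
  rw [e]
  exact (h.stronglyMeasurable.integral_prod_right' (ν := volume.restrict (Ioc 0 δ))).measurable

lemma PT_gm {d : ℕ} {b : EE d → ℝ} (hb : Measurable b) {A : ℝ} (hA : ∀ x, |b x| ≤ A) (δ : ℝ) (hδ : 0 ≤ δ) (m : ℕ)
    (x : EE d) : PT (gm b δ m) δ x = gm b δ (m + 1) x := by
  have e : ∀ m x, gm b δ m x = ∫ ρ in Ioc 0 δ, (PT b (m * δ + ρ) x - PT b (m * δ) x) := by
    intro m x; rw [gm, intervalIntegral.integral_of_le hδ]
  rw [e, PT]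
  simp only [e]
  rw [integral_integral_swap]
  · apply setIntegral_congr_fun measurableSet_Ioc
    intro ρ hρ
    have hρ0 : 0 ≤ ρ := hρ.1.le
    simp only
    have h1 : 0 ≤ (m : ℝ) * δ := by positivity
    rw [integral_sub (PT_integrable (PT_meas1 hb _) (PT_bdd hA _) δ x) (PT_integrable (PT_meas1 hb _) (PT_bdd hA _) δ x)]
    change PT (PT b (m * δ + ρ)) δ x - PT (PT b (m * δ)) δ x = _
    rw [PT_semi hb hA _ _ (by linarith) hδ, PT_semi hb hA _ _ h1 hδ]
    push_cast
    congr 2 <;> ring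
  · refine Integrable.of_bound (C := A + A) ?_ ?_
    · have h : Measurable (fun p : EE d × ℝ => PT b (m * δ + p.2) (x + √δ • p.1) - PT b (m * δ) (x + √δ • p.1)) := by
        apply Measurable.sub
        · exact (PT_meas hb).comp (Measurable.prodMk (by fun_prop) (by fun_prop))
        · exact (PT_meas1 hb _).comp (by fun_prop)
      exact h.aestronglyMeasurable
    · refine Filter.Eventually.of_forall fun p => ?_
      exact (norm_sub_le _ _).trans (add_le_add (PT_bdd hA _ _) (PT_bdd hA _ _))

lemma pow_half_aux (δ α : ℝ) (hδ : 0 < δ) (m : ℝ) (hm : 1 ≤ m) (h1 : α ≤ 1) :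
    (m * δ) ^ (α / 2) ≤ √m * δ ^ (α / 2) := by
  rw [Real.mul_rpow (by linarith) hδ.le, Real.sqrt_eq_rpow]
  gcongr

lemma gm_bound (d : ℕ) : ∃ C : ℝ, 0 < C ∧ ∀ (α : ℝ), 0 ≤ α → α ≤ 1 → ∀ (b : EE d → ℝ) (A H : ℝ), Measurable b →
    (∀ x, |b x| ≤ A) → 0 ≤ H → (∀ x y, |b x - b y| ≤ H * ‖x - y‖ ^ α) → ∀ δ : ℝ, 0 < δ →
    ∀ (m : ℕ) (x : EE d), |gm b δ m x| ≤ C * (H * δ ^ (1 + α / 2)) * (1 / √(m + 1)) := by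
  obtain ⟨C1, hC1, h1⟩ := PT_time d
  obtain ⟨C2, hC2, h2⟩ := PT_near d
  refine ⟨2 * C1 + C2, by positivity, ?_⟩
  intro α ha0 ha1 b A H hb hA hH hbH δ hδ m x
  have hdd : δ ^ (1 + α / 2) = δ ^ (α / 2) * δ := by
    rw [Real.rpow_add hδ, Real.rpow_one, mul_comm]
  have hdp : 0 < δ ^ (α / 2) := by positivity
  have main : ∀ ρ ∈ Set.uIoc 0 δ, ‖PT b (m * δ + ρ) x - PT b (m * δ) x‖ ≤ (2 * C1 + C2) * (H * δ ^ (α / 2)) * (1 / √(m + 1)) := by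
    intro ρ hρ
    rw [Set.uIoc_of_le hδ.le] at hρ
    rcases Nat.eq_zero_or_pos m with hm | hm
    · subst hm
      simp only [Nat.cast_zero, zero_mul, zero_add, Real.sqrt_one, div_one, mul_one]
      rw [PT_zero, Real.norm_eq_abs]
      refine (h2 α ha0 ha1 b A H hb hA hH hbH ρ hρ.1.le x).trans ?_
      have : ρ ^ (α / 2) ≤ δ ^ (α / 2) := Real.rpow_le_rpow hρ.1.le hρ.2 (by linarith)
      calc C2 * (H * ρ ^ (α / 2)) ≤ C2 * (H * δ ^ (α / 2)) := by gcongr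
        _ ≤ _ := by gcongr; linarith
    · have hm1 : (1:ℝ) ≤ m := by exact_mod_cast hm
      have hτ : 0 < (m:ℝ) * δ := by positivity
      have hρτ : ρ ≤ m * δ := hρ.2.trans (by nlinarith)
      refine (h1 α ha0 ha1 b A H hb hA hH hbH (m * δ) ρ hτ hρ.1.le hρτ x).trans ?_
      have q : ρ / (m * δ) ≤ 1 / m := by
        rw [div_le_div_iff₀ hτ (by linarith)]
        nlinarith [hρ.2]
      have sm : √(m + 1 : ℝ) ≤ 2 * √m := by
        rw [show (2:ℝ) = √4 by rw [show (4:ℝ) = 2 ^ 2 by norm_num]; simp, ← Real.sqrt_mul (by norm_num)]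
        apply Real.sqrt_le_sqrt; linarith
      have smp : 0 < √(m:ℝ) := Real.sqrt_pos.2 (by linarith)
      have smp1 : 0 < √(m + 1:ℝ) := Real.sqrt_pos.2 (by linarith)
      have sq : √(m:ℝ) * √m = m := Real.mul_self_sqrt (by linarith)
      calc C1 * (H * (m * δ) ^ (α / 2)) * (ρ / (m * δ)) ≤ C1 * (H * (√m * δ ^ (α / 2))) * (1 / m) := by
            have := pow_half_aux δ α hδ m hm1 ha1
            have q0 : 0 ≤ ρ / (m * δ) := div_nonneg hρ.1.le hτ.le
            gcongr
        _ = C1 * (H * δ ^ (α / 2)) * (1 / √m) := by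
            have e0 : √(m:ℝ) * (1 / m) = 1 / √m := by
              rw [mul_one_div, div_eq_div_iff (by linarith) smp.ne', one_mul]; exact sq
            rw [← e0]; ring
        _ ≤ C1 * (H * δ ^ (α / 2)) * (2 * (1 / √(m + 1))) := by
            gcongr
            rw [mul_one_div, div_le_div_iff₀ smp smp1]
            linarith
        _ = (2 * C1) * (H * δ ^ (α / 2)) * (1 / √(m + 1)) := by ring
        _ ≤ _ := by gcongr; linarith
  have := intervalIntegral.norm_integral_le_of_norm_le_const main
  rw [← Real.norm_eq_abs, gm]
  refine this.trans (le_of_eq ?_)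
  rw [sub_zero, abs_of_pos hδ, hdd]; ring

lemma gm_grad (d : ℕ) : ∃ C : ℝ, 0 < C ∧ ∀ (α : ℝ), 0 ≤ α → α ≤ 1 → ∀ (b : EE d → ℝ) (A H : ℝ), Measurable b →
    (∀ x, |b x| ≤ A) → 0 ≤ H → (∀ x y, |b x - b y| ≤ H * ‖x - y‖ ^ α) → ∀ δ : ℝ, 0 < δ →
    ∀ (m : ℕ), 2 ≤ m → ∀ (x y : EE d), |gm b δ m x - gm b δ m y| ≤ C * (H * δ ^ (1 + α / 2)) * (‖x - y‖ / √δ) * (1 / m) := by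
  obtain ⟨C1, hC1, h1⟩ := PT_time d
  obtain ⟨C3, hC3, h3⟩ := PT_grad d
  refine ⟨C3 * C1 * 4, by positivity, ?_⟩
  intro α ha0 ha1 b A H hb hA hH hbH δ hδ m hm x y
  have hdd : δ ^ (1 + α / 2) = δ ^ (α / 2) * δ := by
    rw [Real.rpow_add hδ, Real.rpow_one, mul_comm]
  have hdp : 0 < δ ^ (α / 2) := by positivity
  have hm2 : (2:ℝ) ≤ m := by exact_mod_cast hm
  set T : ℝ := m * δ / 2 with hT
  have hTp : 0 < T := by positivity
  have hdT : δ ≤ T := by rw [hT]; nlinarith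
  have main : ∀ ρ ∈ Set.uIoc 0 δ, ‖(PT b (m * δ + ρ) x - PT b (m * δ) x) - (PT b (m * δ + ρ) y - PT b (m * δ) y)‖
      ≤ C3 * C1 * 4 * (H * δ ^ (α / 2)) * (‖x - y‖ / √δ) * (1 / m) := by
    intro ρ hρ
    rw [Set.uIoc_of_le hδ.le] at hρ
    have e : ∀ x, PT b (m * δ + ρ) x - PT b (m * δ) x = PT (fun w => PT b (T + ρ) w - PT b T w) T x := by
      intro x
      rw [PT_sub (PT_meas1 hb _) (PT_meas1 hb _) (PT_bdd hA _) (PT_bdd hA _),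
        PT_semi hb hA _ _ (by linarith [hρ.1]) hTp.le, PT_semi hb hA _ _ hTp.le hTp.le]
      congr 2 <;> (rw [hT]; ring)
    rw [e, e, Real.norm_eq_abs]
    have q : ρ / T ≤ 2 / m := by
      rw [hT, div_le_div_iff₀ (by positivity) (by linarith)]
      have := hρ.2
      have : ρ * m ≤ δ * m := by gcongr
      linarith
    have q0 : 0 ≤ ρ / T := div_nonneg hρ.1.le hTp.le
    have pT : T ^ (α / 2) ≤ √(m / 2) * δ ^ (α / 2) := by
      rw [hT, mul_div_right_comm]
      exact pow_half_aux δ α hδ (m / 2) (by linarith) ha1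
    have hbd : ∀ w, |PT b (T + ρ) w - PT b T w| ≤ C1 * (H * (√(m / 2) * δ ^ (α / 2))) * (2 / m) := by
      intro w
      refine (h1 α ha0 ha1 b A H hb hA hH hbH T ρ hTp hρ.1.le (hρ.2.trans hdT) w).trans ?_
      gcongr
    refine (h3 _ _ ((PT_meas1 hb _).sub (PT_meas1 hb _)) (by positivity) hbd T hTp x y).trans ?_
    have sT : √T = √(m / 2) * √δ := by
      rw [← Real.sqrt_mul (by positivity), hT]; congr 1; ring
    have sp : 0 < √((m:ℝ) / 2) := Real.sqrt_pos.2 (by positivity)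
    have sd : 0 < √δ := Real.sqrt_pos.2 hδ
    rw [sT]
    have : C3 * (C1 * (H * (√(m / 2) * δ ^ (α / 2))) * (2 / m)) * (‖x - y‖ / (√(m / 2) * √δ))
      = C3 * C1 * 2 * (H * δ ^ (α / 2)) * (‖x - y‖ / √δ) * (1 / m) := by
      field_simp
    rw [this]
    have n0 : 0 ≤ ‖x - y‖ := norm_nonneg _
    gcongr
    norm_num
  have ii : ∀ x, IntervalIntegrable (fun ρ => PT b (m * δ + ρ) x - PT b (m * δ) x) volume 0 δ := by
    intro x
    rw [intervalIntegrable_iff]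
    refine Measure.integrableOn_of_bounded (M := A + A) (by simp) ?_ ?_
    · have : Measurable (fun ρ => PT b (m * δ + ρ) x - PT b (m * δ) x) := by
        apply Measurable.sub _ measurable_const
        exact (PT_meas hb).comp (Measurable.prodMk (by fun_prop) measurable_const)
      exact this.aestronglyMeasurable
    · refine Filter.Eventually.of_forall fun p => ?_
      exact (norm_sub_le _ _).trans (add_le_add (PT_bdd hA _ _) (PT_bdd hA _ _))
  have := intervalIntegral.norm_integral_le_of_norm_le_const main
  rw [← Real.norm_eq_abs, gm, gm, ← intervalIntegral.integral_sub (ii x) (ii y)]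
  refine this.trans (le_of_eq ?_)
  rw [sub_zero, abs_of_pos hδ, hdd]; ring


lemma pow_le_one_add_pow (x : ℝ) (hx : 0 ≤ x) (j k : ℕ) (h : j ≤ k) : x ^ j ≤ 1 + x ^ k := by
  have h0 : 0 ≤ x ^ k := pow_nonneg hx k
  rcases le_total x 1 with h1 | h1
  · have := pow_le_one₀ (n := j) hx h1
    linarith
  · have := pow_le_pow_right₀ h1 h
    linarith

lemma binom_bound (M : ℕ) (x y : ℝ) :
    (x + y) ^ (2 * M + 2) ≤ x ^ (2 * M + 2) + (2 * M + 2) * (x ^ (2 * M + 1) * y)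
      + 2 ^ (2 * M + 2) * ((1 + x ^ (2 * M)) * (|y| ^ 2 + |y| ^ (2 * M + 2))) := by
  set n := 2 * M + 2 with hn
  set R : ℝ := (1 + x ^ (2 * M)) * (|y| ^ 2 + |y| ^ n) with hR
  have hx2 : x ^ (2 * M) = |x| ^ (2 * M) := by
    rw [pow_mul, pow_mul, sq_abs]
  have hR0 : 0 ≤ R := by
    rw [hR, hx2]; positivity
  rw [add_comm x y, add_pow]
  have key : ∀ m ∈ Finset.range (n + 1), y ^ m * x ^ (n - m) * (n.choose m : ℝ) ≤
      (if m = 0 then x ^ n else 0) + (if m = 1 then (n:ℝ) * (x ^ (2 * M + 1) * y) else 0) + R * (n.choose m : ℝ) := by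
    intro m hm
    have hc : (0:ℝ) ≤ (n.choose m : ℝ) := Nat.cast_nonneg _
    have hm' : m ≤ n := by simpa [Nat.lt_succ_iff] using hm
    rcases m with _ | _ | m
    · simp; linarith
    · have e : n - (0 + 1) = 2 * M + 1 := by omega
      rw [e]
      simp
      nlinarith [mul_nonneg hR0 (Nat.cast_nonneg (α := ℝ) n)]
    · have e1 : m + 1 + 1 ≠ 0 := by omega
      have e2 : m + 1 + 1 ≠ 1 := by omega
      rw [if_neg e1, if_neg e2, zero_add, zero_add]
      refine mul_le_mul_of_nonneg_right ?_ hc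
      refine (le_abs_self _).trans ?_
      rw [abs_mul, abs_pow, abs_pow, hR, hx2, mul_comm]
      apply mul_le_mul _ _ (by positivity) (by positivity)
      · exact pow_le_one_add_pow _ (abs_nonneg _) _ _ (by omega)
      · have := pow_le_one_add_pow |y| (abs_nonneg _) m (2 * M) (by omega)
        calc |y| ^ (m + 1 + 1) = |y| ^ 2 * |y| ^ m := by ring
          _ ≤ |y| ^ 2 * (1 + |y| ^ (2 * M)) := by gcongr
          _ = _ := by rw [hn]; ring
  refine (Finset.sum_le_sum key).trans (le_of_eq ?_)
  rw [Finset.sum_add_distrib, Finset.sum_add_distrib, Finset.sum_ite_eq', Finset.sum_ite_eq', ← Finset.mul_sum]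
  have h2 : ∑ m ∈ Finset.range (n + 1), (n.choose m : ℝ) = 2 ^ n := by
    exact_mod_cast Nat.sum_range_choose n
  rw [h2, if_pos (by simp), if_pos (by simp [hn]), hn]
  push_cast; ring

lemma cond_mom {Ω : Type} {F : MeasurableSpace Ω} [m0 : MeasurableSpace Ω] {P : Measure Ω} [IsProbabilityMeasure P]
    (hF : F ≤ m0) {D : Ω → ℝ} (hD : Measurable D) {A : ℝ} (hA : 0 ≤ A) (l : ℕ)
    (h : ∀ Y : Ω → ENNReal, Measurable[F] Y → ∫⁻ ω, Y ω * ‖D ω‖ₑ ^ l ∂P ≤ ENNReal.ofReal A * ∫⁻ ω, Y ω ∂P)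
    (Y : Ω → ℝ) (hY : Measurable[F] Y) (hYi : Integrable Y P) :
    Integrable (fun ω => Y ω * |D ω| ^ l) P ∧ ((∀ ω, 0 ≤ Y ω) → ∫ ω, Y ω * |D ω| ^ l ∂P ≤ A * ∫ ω, Y ω ∂P) := by
  have h1 := h (fun ω => ‖Y ω‖ₑ) (measurable_enorm.comp hY)
  have e : ∀ ω, ‖Y ω * |D ω| ^ l‖ₑ = ‖Y ω‖ₑ * ‖D ω‖ₑ ^ l := by
    intro ω
    rw [enorm_mul, enorm_pow, Real.enorm_abs]
  have hi : Integrable (fun ω => Y ω * |D ω| ^ l) P := by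
    have hm : Measurable (fun ω => Y ω * |D ω| ^ l) := (hY.mono hF le_rfl).mul (hD.abs.pow_const l)
    refine ⟨hm.aestronglyMeasurable, ?_⟩
    unfold HasFiniteIntegral
    simp only [e]
    refine h1.trans_lt (ENNReal.mul_lt_top ENNReal.ofReal_lt_top hYi.2)
  refine ⟨hi, fun h0 => ?_⟩
  rw [← ENNReal.ofReal_le_ofReal_iff (mul_nonneg hA (integral_nonneg h0)), ENNReal.ofReal_mul hA,
    ofReal_integral_eq_lintegral_ofReal hYi (Filter.Eventually.of_forall h0),
    ofReal_integral_eq_lintegral_ofReal hi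
      (Filter.Eventually.of_forall fun ω => mul_nonneg (h0 ω) (pow_nonneg (abs_nonneg _) _))]
  have e2 : ∀ ω, ENNReal.ofReal (Y ω * |D ω| ^ l) = ‖Y ω‖ₑ * ‖D ω‖ₑ ^ l := by
    intro ω
    rw [← e, Real.enorm_of_nonneg (mul_nonneg (h0 ω) (pow_nonneg (abs_nonneg _) _))]
  have e3 : ∀ ω, ENNReal.ofReal (Y ω) = ‖Y ω‖ₑ := fun ω => (Real.enorm_of_nonneg (h0 ω)).symm
  simp only [e2, e3]
  exact h1

lemma mart_moment (A : ℕ → ℝ) (hA : ∀ l, 0 ≤ A l) (M : ℕ) : ∃ a : ℝ, 0 ≤ a ∧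
    ∀ (Ω : Type) [m0 : MeasurableSpace Ω] (P : Measure Ω) [IsProbabilityMeasure P] (K : ℕ)
      (F : ℕ → MeasurableSpace Ω) (S D : ℕ → Ω → ℝ), (∀ k, F k ≤ m0) → (∀ ω, S 0 ω = 0) →
      (∀ k < K, ∀ ω, S (k + 1) ω = S k ω + D k ω) → (∀ k < K, Measurable[F k] (S k)) →
      (∀ k < K, Measurable (D k)) →
      (∀ k < K, ∀ (l : ℕ) (Y : Ω → ENNReal), Measurable[F k] Y →
        ∫⁻ ω, Y ω * ‖D k ω‖ₑ ^ l ∂P ≤ ENNReal.ofReal (A l) * ∫⁻ ω, Y ω ∂P) →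
      (∀ k < K, ∀ Y : Ω → ℝ, Measurable[F k] Y → Integrable Y P → ∫ ω, Y ω * D k ω ∂P = 0) →
      ∀ k ≤ K, Integrable (fun ω => S k ω ^ (2 * M)) P ∧ ∫ ω, S k ω ^ (2 * M) ∂P ≤ a * (K : ℝ) ^ M := by
  induction M with
  | zero =>
    refine ⟨1, zero_le_one, ?_⟩
    intros
    simp
  | succ M ih =>
    obtain ⟨a, ha, ih⟩ := ih
    set c : ℝ := 2 ^ (2 * M + 2) * (A 2 + A (2 * M + 2)) with hc
    have hc0 : 0 ≤ c := mul_nonneg (by positivity) (add_nonneg (hA _) (hA _))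
    refine ⟨c * (1 + a), by positivity, ?_⟩
    intro Ω m0 P hP K F S D hF hS0 hS hSm hDm hl hz
    have ih' := ih Ω P K F S D hF hS0 hS hSm hDm hl hz
    -- integrability of all powers
    have hInt0 : ∀ k ≤ K, (∀ l : ℕ, Integrable (fun ω => S k ω ^ l) P) := by
      intro k
      have hmem : k ≤ K → Measurable (S k) ∧ ∀ l : ℕ, MemLp (S k) l P := by
        induction k with
        | zero =>
          intro _
          have : S 0 = fun _ => 0 := funext hS0
          rw [this]
          exact ⟨measurable_const, fun l => memLp_const 0⟩
        | succ k ihk =>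
          intro hk
          have hkK : k < K := hk
          obtain ⟨h1, h2⟩ := ihk hkK.le
          have e : S (k + 1) = S k + D k := funext (hS k hkK)
          rw [e]
          refine ⟨h1.add (hDm k hkK), fun l => (h2 l).add ?_⟩
          rcases Nat.eq_zero_or_pos l with h0 | h0
          · subst h0
            simpa using (hDm k hkK).aestronglyMeasurable
          have := (cond_mom (hF k) (hDm k hkK) (hA l) l (hl k hkK l) (fun _ => 1) measurable_const
            (integrable_const _)).1
          simp only [one_mul] at this
          rw [← integrable_norm_rpow_iff (hDm k hkK).aestronglyMeasurable (by exact_mod_cast h0.ne') (by simp)]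
          simp only [ENNReal.toReal_natCast, Real.rpow_natCast]
          exact this
      intro hk l
      have := ((hmem hk).2 l).integrable_norm_pow'
      refine Integrable.mono' this ((hmem hk).1.pow_const l).aestronglyMeasurable
        (Filter.Eventually.of_forall fun ω => ?_)
      rw [norm_pow]
    have step : ∀ k < K, ∫ ω, S (k + 1) ω ^ (2 * M + 2) ∂P ≤ ∫ ω, S k ω ^ (2 * M + 2) ∂P + c * (1 + a * (K:ℝ) ^ M) := by
      intro k hk
      have hY0 : ∀ ω, 0 ≤ 1 + S k ω ^ (2 * M) := fun ω => by
        have : 0 ≤ S k ω ^ (2 * M) := by rw [pow_mul]; positivity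
        linarith
      have hYm : Measurable[F k] (fun ω => 1 + S k ω ^ (2 * M)) :=
        Measurable.const_add ((hSm k hk).pow_const _) 1
      have hYi : Integrable (fun ω => 1 + S k ω ^ (2 * M)) P :=
        (integrable_const (1:ℝ)).add (hInt0 k hk.le (2 * M))
      obtain ⟨i2, b2⟩ := cond_mom (hF k) (hDm k hk) (hA 2) 2 (hl k hk 2) _ hYm hYi
      obtain ⟨i3, b3⟩ := cond_mom (hF k) (hDm k hk) (hA (2*M+2)) (2*M+2) (hl k hk (2*M+2)) _ hYm hYi
      have hX := hInt0 k hk.le (2 * M + 1)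
      have hXm : Measurable[F k] (fun ω => S k ω ^ (2 * M + 1)) := (hSm k hk).pow_const _
      have hXD : Integrable (fun ω => S k ω ^ (2 * M + 1) * D k ω) P := by
        have := (cond_mom (hF k) (hDm k hk) (hA 1) 1 (hl k hk 1) _ hXm hX).1
        refine Integrable.mono this ((hXm.mono (hF k) le_rfl).mul (hDm k hk)).aestronglyMeasurable
          (Filter.Eventually.of_forall fun ω => ?_)
        simp
      have z := hz k hk _ hXm hX
      have h5 : ∫ ω, (1 + S k ω ^ (2 * M)) ∂P ≤ 1 + a * (K:ℝ) ^ M := by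
        rw [integral_add (integrable_const _) (hInt0 k hk.le (2 * M))]
        simp only [integral_const, probReal_univ, smul_eq_mul, mul_one]
        linarith [(ih' k hk.le).2]
      have I1 : Integrable (fun ω => S k ω ^ (2 * M + 2) + (2 * M + 2) * (S k ω ^ (2 * M + 1) * D k ω)) P :=
        (hInt0 k hk.le (2 * M + 2)).add (hXD.const_mul _)
      have I23 : Integrable (fun ω => (1 + S k ω ^ (2 * M)) * |D k ω| ^ 2 + (1 + S k ω ^ (2 * M)) * |D k ω| ^ (2 * M + 2)) P := i2.add i3
      have I2 : Integrable (fun ω => 2 ^ (2 * M + 2) * ((1 + S k ω ^ (2 * M)) * |D k ω| ^ 2 + (1 + S k ω ^ (2 * M)) * |D k ω| ^ (2 * M + 2))) P :=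
        I23.const_mul _
      calc ∫ ω, S (k + 1) ω ^ (2 * M + 2) ∂P
          ≤ ∫ ω, ((S k ω ^ (2 * M + 2) + (2 * M + 2) * (S k ω ^ (2 * M + 1) * D k ω)) +
            2 ^ (2 * M + 2) * ((1 + S k ω ^ (2 * M)) * |D k ω| ^ 2 + (1 + S k ω ^ (2 * M)) * |D k ω| ^ (2 * M + 2))) ∂P := by
            refine integral_mono (hInt0 (k+1) hk (2 * M + 2)) (I1.add I2) fun ω => ?_
            simp only [hS k hk ω]
            refine (binom_bound M _ _).trans (le_of_eq ?_)
            ring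
        _ = (∫ ω, S k ω ^ (2 * M + 2) ∂P + (2 * M + 2) * 0) + 2 ^ (2 * M + 2) *
            (∫ ω, (1 + S k ω ^ (2 * M)) * |D k ω| ^ 2 ∂P + ∫ ω, (1 + S k ω ^ (2 * M)) * |D k ω| ^ (2 * M + 2) ∂P) := by
            rw [integral_add I1 I2, integral_add (hInt0 k hk.le (2 * M + 2)) (hXD.const_mul _), integral_const_mul,
              integral_const_mul, z, integral_add i2 i3]
        _ ≤ (∫ ω, S k ω ^ (2 * M + 2) ∂P + (2 * M + 2) * 0) + 2 ^ (2 * M + 2) *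
            (A 2 * (1 + a * (K:ℝ) ^ M) + A (2 * M + 2) * (1 + a * (K:ℝ) ^ M)) := by
            gcongr
            · exact (b2 hY0).trans (mul_le_mul_of_nonneg_left h5 (hA _))
            · exact (b3 hY0).trans (mul_le_mul_of_nonneg_left h5 (hA _))
        _ = _ := by rw [hc]; ring
    have tot : ∀ k ≤ K, ∫ ω, S k ω ^ (2 * M + 2) ∂P ≤ k * (c * (1 + a * (K:ℝ) ^ M)) := by
      intro k
      induction k with
      | zero => intro _; simp [hS0]
      | succ k ihk =>
        intro hk
        have h1 := ihk (by omega)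
        have h2 := step k hk
        push_cast
        linarith
    intro k hk
    refine ⟨hInt0 k hk _, ?_⟩
    have h3 : 2 * (M + 1) = 2 * M + 2 := by ring
    rw [h3]
    refine (tot k hk).trans ?_
    rcases Nat.eq_zero_or_pos k with h0 | h0
    · subst h0
      simp; positivity
    have hK1 : (1:ℝ) ≤ K := by exact_mod_cast (h0.trans_le hk : 0 < K)
    have hkK : (k:ℝ) ≤ K := by exact_mod_cast hk
    have hKM : (1:ℝ) ≤ (K:ℝ) ^ M := one_le_pow₀ hK1
    calc (k:ℝ) * (c * (1 + a * (K:ℝ) ^ M)) ≤ K * (c * ((K:ℝ) ^ M + a * (K:ℝ) ^ M)) := by gcongr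
      _ = _ := by ring


lemma jensen_pow (u v : ℝ) (huv : u ≤ v) (f : ℝ → ℝ) (hf : Measurable f) (m : ℕ) :
    ‖∫ r in u..v, f r‖ₑ ^ (m + 1) ≤ ENNReal.ofReal (v - u) ^ m * ∫⁻ r in Ioc u v, ‖f r‖ₑ ^ (m + 1) := by
  rw [intervalIntegral.integral_of_le huv]
  set μ := (volume : Measure ℝ).restrict (Ioc u v) with hμ
  have h1 : ‖∫ r, f r ∂μ‖ₑ ≤ eLpNorm f 1 μ := by
    rw [eLpNorm_one_eq_lintegral_enorm]; exact enorm_integral_le_lintegral_enorm f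
  have hm1 : ((m + 1 : ℕ) : ENNReal) ≠ 0 := by simp
  have h2 : eLpNorm f 1 μ ≤ _ :=
    eLpNorm_le_eLpNorm_mul_rpow_measure_univ (p := 1) (q := ((m + 1 : ℕ) : ENNReal)) (by simp) hf.aestronglyMeasurable
  have e1 : μ univ = ENNReal.ofReal (v - u) := by rw [hμ]; simp
  rw [e1] at h2
  refine (pow_le_pow_left' (h1.trans h2) (m + 1)).trans (le_of_eq ?_)
  rw [mul_pow, mul_comm]
  congr 1
  · rw [← ENNReal.rpow_natCast, ← ENNReal.rpow_mul, ← ENNReal.rpow_natCast]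
    congr 1
    have : ((m:ℝ) + 1) ≠ 0 := by positivity
    rw [ENNReal.toReal_natCast, ENNReal.toReal_one]
    push_cast
    field_simp
    ring
  · rw [eLpNorm_eq_lintegral_rpow_enorm_toReal hm1 (by simp), ← ENNReal.rpow_natCast, ← ENNReal.rpow_mul]
    simp only [ENNReal.toReal_natCast, ENNReal.rpow_natCast]
    have : ((m + 1 : ℕ) : ℝ) ≠ 0 := by positivity
    rw [one_div, inv_mul_cancel₀ this, ENNReal.rpow_one]

lemma fub_pow {Ω : Type} [m0 : MeasurableSpace Ω] (P : Measure Ω) [IsProbabilityMeasure P]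
    (u v : ℝ) (huv : u ≤ v) (f : ℝ → Ω → ℝ) (hf : Measurable (Function.uncurry f)) (m : ℕ)
    (Y : Ω → ENNReal) (hY : Measurable Y) (A : ENNReal)
    (h : ∀ r ∈ Ioc u v, ∫⁻ ω, Y ω * ‖f r ω‖ₑ ^ (m + 1) ∂P ≤ A * ∫⁻ ω, Y ω ∂P) :
    ∫⁻ ω, Y ω * ‖∫ r in u..v, f r ω‖ₑ ^ (m + 1) ∂P ≤ ENNReal.ofReal (v - u) ^ (m + 1) * A * ∫⁻ ω, Y ω ∂P := by
  have hg : Measurable (fun q : Ω × ℝ => ‖f q.2 q.1‖ₑ ^ (m + 1)) := by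
    have : Measurable (fun q : Ω × ℝ => f q.2 q.1) := hf.comp measurable_swap
    fun_prop
  calc ∫⁻ ω, Y ω * ‖∫ r in u..v, f r ω‖ₑ ^ (m + 1) ∂P
      ≤ ∫⁻ ω, (ENNReal.ofReal (v - u) ^ m * (∫⁻ r in Ioc u v, Y ω * ‖f r ω‖ₑ ^ (m + 1))) ∂P := by
        apply lintegral_mono
        intro ω
        simp only
        have hfm : Measurable (fun r => f r ω) := hf.comp (measurable_id.prodMk measurable_const)
        have := jensen_pow u v huv (fun r => f r ω) hfm m
        rw [lintegral_const_mul _ (by fun_prop)]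
        calc _ ≤ Y ω * (ENNReal.ofReal (v - u) ^ m * ∫⁻ r in Ioc u v, ‖f r ω‖ₑ ^ (m + 1)) := by gcongr
          _ = _ := by ring
    _ = ENNReal.ofReal (v - u) ^ m * ∫⁻ r in Ioc u v, ∫⁻ ω, Y ω * ‖f r ω‖ₑ ^ (m + 1) ∂P := by
        have hg2 : Measurable (fun q : Ω × ℝ => Y q.1 * ‖f q.2 q.1‖ₑ ^ (m + 1)) :=
          (hY.comp measurable_fst).mul hg
        rw [lintegral_const_mul, lintegral_lintegral_swap]
        · exact hg2.aemeasurable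
        · exact hg2.lintegral_prod_right'
    _ ≤ ENNReal.ofReal (v - u) ^ m * ∫⁻ r in Ioc u v, A * ∫⁻ ω, Y ω ∂P := by
        refine mul_le_mul_right ?_ _
        exact setLIntegral_mono measurable_const h
    _ = _ := by
        rw [setLIntegral_const, Real.volume_Ioc]; ring

section BM
set_option linter.unusedSectionVars false
variable {Ω : Type} [m0 : MeasurableSpace Ω] {P : Measure Ω} [IsProbabilityMeasure P]
  {ℱ : ℝ → MeasurableSpace Ω} {d : ℕ} {B : ℝ → Ω → EE d}

lemma bm_inc (hB : IsBrownianMotion P ℱ B) (hle : ∀ t, ℱ t ≤ m0) (s t : ℝ) (hs : 0 ≤ s) (hst : s ≤ t) (ht : t ≤ 1) :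
    P.map (fun ω => B t ω - B s ω) = (gam d).map (fun z => √(t - s) • z) := by
  rw [← law_pi d (t - s) (by linarith), ← hB.law s t hs hst ht, Measure.map_map (by fun_prop)]
  · rfl
  · have h1 : Measurable (B t) := (hB.adapted t (hs.trans hst) ht).mono (hle _) le_rfl
    have h2 : Measurable (B s) := (hB.adapted s hs (hst.trans ht)).mono (hle _) le_rfl
    fun_prop

lemma bm_indep (hB : IsBrownianMotion P ℱ B) (s t : ℝ) (hs : 0 ≤ s) (hst : s ≤ t) (ht : t ≤ 1) :
    Indep (MeasurableSpace.comap (fun ω => B t ω - B s ω) inferInstance) (ℱ s) P := by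
  refine indep_of_indep_of_le_left (hB.indep s t hs hst ht) ?_
  have : (fun ω => B t ω - B s ω) = (WithLp.toLp 2) ∘ (fun ω => fun i => B t ω i - B s ω i) := rfl
  rw [this, ← MeasurableSpace.comap_comp]
  apply MeasurableSpace.comap_mono
  have hm : Measurable (WithLp.toLp 2 : (Fin d → ℝ) → EE d) := by fun_prop
  exact hm.comap_le

lemma bm_meas (hB : IsBrownianMotion P ℱ B) (hle : ∀ t, ℱ t ≤ m0) (t : ℝ) (h0 : 0 ≤ t) (h1 : t ≤ 1) :
    Measurable (B t) := (hB.adapted t h0 h1).mono (hle _) le_rfl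

lemma bm_lint (hB : IsBrownianMotion P ℱ B) (hle : ∀ t, ℱ t ≤ m0) (s t : ℝ) (hs : 0 ≤ s) (hst : s ≤ t) (ht : t ≤ 1)
    (Y : Ω → ENNReal) (hY : Measurable[ℱ s] Y) (φ : EE d → ENNReal) (hφ : Measurable φ) :
    ∫⁻ ω, Y ω * φ (B t ω - B s ω) ∂P = (∫⁻ ω, Y ω ∂P) * ∫⁻ z, φ (√(t - s) • z) ∂(gam d) := by
  have hW : Measurable (fun ω => B t ω - B s ω) :=
    (bm_meas hB hle t (hs.trans hst) ht).sub (bm_meas hB hle s hs (hst.trans ht))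
  have := lintegral_mul_eq_lintegral_mul_lintegral_of_independent_measurableSpace (hle s) hW.comap_le
    (bm_indep hB s t hs hst ht).symm hY (hφ.comp (comap_measurable _))
  refine this.trans ?_
  congr 1
  change ∫⁻ ω, φ (B t ω - B s ω) ∂P = _
  rw [← lintegral_map hφ hW, bm_inc hB hle s t hs hst ht, lintegral_map hφ (by fun_prop)]

lemma bm_cond (hB : IsBrownianMotion P ℱ B) (hle : ∀ t, ℱ t ≤ m0) (s t : ℝ) (hs : 0 ≤ s) (hst : s ≤ t) (ht : t ≤ 1)
    (Y : Ω → ℝ) (hY : Measurable[ℱ s] Y) (hYi : Integrable Y P) (f : EE d → ℝ) (hf : Measurable f) (A : ℝ)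
    (hA : ∀ x, |f x| ≤ A) :
    ∫ ω, Y ω * f (B t ω) ∂P = ∫ ω, Y ω * PT f (t - s) (B s ω) ∂P := by
  have hmt := bm_meas hB hle t (hs.trans hst) ht
  have hms := bm_meas hB hle s hs (hst.trans ht)
  have hW : Measurable (fun ω => B t ω - B s ω) := hmt.sub hms
  have hY0 : Measurable Y := hY.mono (hle s) le_rfl
  have hG : Measurable (fun ω => (Y ω, B s ω)) := hY0.prodMk hms
  have hGs : Measurable[ℱ s] (fun ω => (Y ω, B s ω)) := hY.prodMk (hB.adapted s hs (hst.trans ht))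
  have hind : IndepFun (fun ω => (Y ω, B s ω)) (fun ω => B t ω - B s ω) P := by
    rw [IndepFun_iff_Indep]
    exact indep_of_indep_of_le_left (bm_indep hB s t hs hst ht).symm hGs.comap_le
  have hmap := (indepFun_iff_map_prod_eq_prod_map_map hG.aemeasurable hW.aemeasurable).1 hind
  rw [bm_inc hB hle s t hs hst ht] at hmap
  have hφ : Measurable (fun q : (ℝ × EE d) × EE d => q.1.1 * f (q.1.2 + q.2)) := by fun_prop
  have e1 : ∫ ω, Y ω * f (B t ω) ∂P =
      ∫ q, q.1.1 * f (q.1.2 + q.2) ∂(P.map (fun ω => ((Y ω, B s ω), B t ω - B s ω))) := by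
    rw [integral_map (hG.prodMk hW).aemeasurable hφ.aestronglyMeasurable]
    simp
  have hInt0 : Integrable (fun q : (ℝ × EE d) × EE d => q.1.1 * f (q.1.2 + q.2))
      (P.map (fun ω => ((Y ω, B s ω), B t ω - B s ω))) := by
    rw [integrable_map_measure hφ.aestronglyMeasurable (hG.prodMk hW).aemeasurable]
    refine Integrable.mono' (hYi.norm.mul_const A) (hφ.comp (hG.prodMk hW)).aestronglyMeasurable
      (Filter.Eventually.of_forall fun ω => ?_)
    simp only [Function.comp, norm_mul]
    exact mul_le_mul_of_nonneg_left (hA _) (norm_nonneg _)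
  rw [e1]
  rw [hmap] at hInt0 ⊢
  rw [integral_prod _ hInt0]
  have e2 : ∀ x : ℝ × EE d, ∫ y, x.1 * f (x.2 + y) ∂((gam d).map (fun z => √(t - s) • z)) = x.1 * PT f (t - s) x.2 := by
    intro x
    have hm : Measurable (fun y => f (x.2 + y)) := by fun_prop
    rw [integral_const_mul, integral_map (by fun_prop) hm.aestronglyMeasurable, PT]
  simp only [e2]
  have hm2 : Measurable (fun x : ℝ × EE d => x.1 * PT f (t - s) x.2) :=
    measurable_fst.mul ((PT_meas1 hf _).comp measurable_snd)
  rw [integral_map hG.aemeasurable hm2.aestronglyMeasurable]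

noncomputable def Gl (d l : ℕ) : ℝ := ∫ z, (1 + ‖z‖) ^ l ∂(gam d)

lemma Gl_one (d l : ℕ) : 1 ≤ Gl d l := by
  have : ∫ z : EE d, (1:ℝ) ∂(gam d) ≤ Gl d l := by
    refine integral_mono (integrable_const _) (gam_moment d l) fun z => ?_
    exact one_le_pow₀ (by linarith [norm_nonneg z])
  simpa using this

lemma bm_V (hB : IsBrownianMotion P ℱ B) (hle : ∀ t, ℱ t ≤ m0) (δ s t : ℝ) (hδ : 0 < δ) (hs : 0 ≤ s) (hst : s ≤ t) (ht : t ≤ 1)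
    (htd : t ≤ s + δ) (Y : Ω → ENNReal) (hY : Measurable[ℱ s] Y) (l : ℕ) :
    ∫⁻ ω, Y ω * ENNReal.ofReal (1 + ‖B t ω - B s ω‖ / √δ) ^ l ∂P ≤ ENNReal.ofReal (Gl d l) * ∫⁻ ω, Y ω ∂P := by
  have hm : Measurable (fun w : EE d => ENNReal.ofReal (1 + ‖w‖ / √δ) ^ l) := by fun_prop
  rw [bm_lint hB hle s t hs hst ht Y hY _ hm, mul_comm]
  gcongr
  rw [Gl, ofReal_integral_eq_lintegral_ofReal (gam_moment d l)
    (Filter.Eventually.of_forall fun z => pow_nonneg (add_nonneg zero_le_one (norm_nonneg z)) l)]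
  apply lintegral_mono
  intro z
  have sd : 0 < √δ := Real.sqrt_pos.2 hδ
  have h0 : (0:ℝ) ≤ 1 + ‖√(t - s) • z‖ / √δ := add_nonneg zero_le_one (div_nonneg (norm_nonneg _) sd.le)
  simp only
  rw [← ENNReal.ofReal_pow h0]
  apply ENNReal.ofReal_le_ofReal
  apply pow_le_pow_left₀ h0
  rw [norm_smul, Real.norm_of_nonneg (Real.sqrt_nonneg _)]
  have : √(t - s) ≤ √δ := Real.sqrt_le_sqrt (by linarith)
  have : √(t - s) * ‖z‖ / √δ ≤ ‖z‖ := by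
    rw [div_le_iff₀ sd, mul_comm]
    exact mul_le_mul_of_nonneg_left this (norm_nonneg z)
  linarith

lemma hold_V {b : EE d → ℝ} {H α : ℝ} (hH : 0 ≤ H) (h0 : 0 ≤ α) (h1 : α ≤ 1)
    (hbH : ∀ x y, |b x - b y| ≤ H * ‖x - y‖ ^ α) (δ : ℝ) (hδ : 0 < δ) (x y : EE d) :
    |b x - b y| ≤ H * δ ^ (α / 2) * (1 + ‖x - y‖ / √δ) := by
  refine (hbH x y).trans ?_
  rw [mul_assoc]
  apply mul_le_mul_of_nonneg_left _ hH
  have sd : 0 < √δ := Real.sqrt_pos.2 hδ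
  have := hold_lin α δ h0 h1 hδ.le ((√δ)⁻¹ • (x - y))
  rw [smul_smul, mul_inv_cancel₀ sd.ne', one_smul, norm_smul, norm_inv, Real.norm_of_nonneg sd.le, inv_mul_eq_div] at this
  exact this

lemma bm_R (hB : IsBrownianMotion P ℱ B) (hle : ∀ t, ℱ t ≤ m0) {b : EE d → ℝ} {H α : ℝ} (hH : 0 ≤ H) (h0 : 0 ≤ α) (h1 : α ≤ 1)
    (hbH : ∀ x y, |b x - b y| ≤ H * ‖x - y‖ ^ α) (δ s t : ℝ) (hδ : 0 < δ) (hs : 0 ≤ s) (hst : s ≤ t) (ht : t ≤ 1)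
    (htd : t ≤ s + δ) (Y : Ω → ENNReal) (hY : Measurable[ℱ s] Y) (l : ℕ) :
    ∫⁻ ω, Y ω * ‖b (B t ω) - b (B s ω)‖ₑ ^ l ∂P ≤
      (ENNReal.ofReal (H * δ ^ (α / 2)) ^ l * ENNReal.ofReal (Gl d l)) * ∫⁻ ω, Y ω ∂P := by
  have hc : 0 ≤ H * δ ^ (α / 2) := mul_nonneg hH (Real.rpow_nonneg hδ.le _)
  calc _ ≤ ∫⁻ ω, ENNReal.ofReal (H * δ ^ (α / 2)) ^ l * (Y ω * ENNReal.ofReal (1 + ‖B t ω - B s ω‖ / √δ) ^ l) ∂P := by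
        apply lintegral_mono
        intro ω
        simp only
        rw [mul_left_comm, ← mul_pow, ← ENNReal.ofReal_mul hc, ← ofReal_norm]
        gcongr
        exact hold_V hH h0 h1 hbH δ hδ _ _
    _ = ENNReal.ofReal (H * δ ^ (α / 2)) ^ l * ∫⁻ ω, (Y ω * ENNReal.ofReal (1 + ‖B t ω - B s ω‖ / √δ) ^ l) ∂P := by
        rw [lintegral_const_mul']
        simp
    _ ≤ _ := by
        rw [mul_assoc]
        gcongr
        exact bm_V hB hle δ s t hδ hs hst ht htd Y hY l

end BM


lemma adapt_gen {Ω : Type} [m : MeasurableSpace Ω] {d : ℕ} (u : ℝ → Ω → EE d) (hc : ∀ ω, Continuous (fun r => u r ω))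
    (hu : ∀ r, Measurable (u r)) {b : EE d → ℝ} (hb : Measurable b) (δ : ℝ) (hδ : 0 ≤ δ) :
    Measurable (fun ω => ∫ ρ in (0:ℝ)..δ, (b (u ρ ω) - b (u 0 ω))) := by
  have h1 : Measurable (Function.uncurry u) := measurable_uncurry_of_continuous_of_measurable hc hu
  have h2 : Measurable (fun q : Ω × ℝ => b (u q.2 q.1) - b (u 0 q.1)) := by
    have h3 : Measurable (fun q : Ω × ℝ => u q.2 q.1) := h1.comp measurable_swap
    have h4 : Measurable (fun q : Ω × ℝ => u 0 q.1) := (hu 0).comp measurable_fst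
    exact (hb.comp h3).sub (hb.comp h4)
  simp only [intervalIntegral.integral_of_le hδ]
  exact (h2.stronglyMeasurable.integral_prod_right' (ν := volume.restrict (Ioc 0 δ))).measurable

lemma ennreal_add_pow (a b : ENNReal) (l : ℕ) : (a + b) ^ l ≤ 2 ^ l * (a ^ l + b ^ l) := by
  rcases le_total a b with h | h
  · calc (a + b) ^ l ≤ (b + b) ^ l := by gcongr
      _ = 2 ^ l * b ^ l := by rw [← two_mul, mul_pow]
      _ ≤ _ := by gcongr; exact le_add_self
  · calc (a + b) ^ l ≤ (a + a) ^ l := by gcongr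
      _ = 2 ^ l * a ^ l := by rw [← two_mul, mul_pow]
      _ ≤ _ := by gcongr; exact le_self_add

lemma sum_inv_sqrt (K : ℕ) : ∑ m ∈ Finset.range K, 1 / √((m:ℝ) + 1) ≤ 2 * √K := by
  induction K with
  | zero => simp
  | succ K ih =>
    rw [Finset.sum_range_succ]
    have h1 : 0 < √((K:ℝ) + 1) := Real.sqrt_pos.2 (by positivity)
    have h2 : √((K:ℝ) + 1) * √((K:ℝ) + 1) = K + 1 := Real.mul_self_sqrt (by positivity)
    have h3 : √(K:ℝ) * √(K:ℝ) = K := Real.mul_self_sqrt (by positivity)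
    have h4 : 1 / √((K:ℝ) + 1) ≤ 2 * (√((K:ℝ) + 1) - √K) := by
      rw [div_le_iff₀ h1]
      nlinarith [sq_nonneg (√((K:ℝ) + 1) - √K)]
    push_cast
    linarith

lemma sum_inv (ε : ℝ) (hε : 0 < ε) (L K : ℕ) (hL : L ≤ K) (hK : 1 ≤ K) :
    ∑ m ∈ Finset.range L, 1 / ((m:ℝ) + 1) ≤ (1 + 1 / ε) * (K:ℝ) ^ ε := by
  have h1 : ∑ m ∈ Finset.range L, 1 / ((m:ℝ) + 1) ≤ ∑ m ∈ Finset.range K, 1 / ((m:ℝ) + 1) :=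
    Finset.sum_le_sum_of_subset_of_nonneg (Finset.range_mono hL) (fun i _ _ => by positivity)
  have h2 : ∑ m ∈ Finset.range K, 1 / ((m:ℝ) + 1) = (harmonic K : ℝ) := by
    simp [harmonic]
  have h3 := harmonic_le_one_add_log K
  have hK1 : (1:ℝ) ≤ K := by exact_mod_cast hK
  have h4 := Real.log_le_rpow_div (x := (K:ℝ)) (by positivity) hε
  have h5 : 1 ≤ (K:ℝ) ^ ε := Real.one_le_rpow hK1 hε.le
  rw [h2] at h1
  have : (1 + 1 / ε) * (K:ℝ) ^ ε = (K:ℝ) ^ ε + (K:ℝ) ^ ε / ε := by ring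
  linarith

noncomputable def Phi {d : ℕ} (b : EE d → ℝ) (δ : ℝ) (L : ℕ) (x : EE d) : ℝ :=
  ∑ m ∈ Finset.range L, gm b δ m x

lemma Phi_meas {d : ℕ} {b : EE d → ℝ} (hb : Measurable b) (δ : ℝ) (hδ : 0 ≤ δ) (L : ℕ) : Measurable (Phi b δ L) := by
  unfold Phi
  exact Finset.measurable_fun_sum _ fun m _ => gm_meas hb δ hδ m

lemma gm_bdd {d : ℕ} {b : EE d → ℝ} {A : ℝ} (hA : ∀ x, |b x| ≤ A) (δ : ℝ) (hδ : 0 ≤ δ) (m : ℕ) (x : EE d) :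
    |gm b δ m x| ≤ (A + A) * δ := by
  have := intervalIntegral.norm_integral_le_of_norm_le_const (a := 0) (b := δ) (C := A + A)
    (f := fun ρ => PT b (m * δ + ρ) x - PT b (m * δ) x)
    (fun ρ _ => (norm_sub_le _ _).trans (add_le_add (PT_bdd hA _ _) (PT_bdd hA _ _)))
  rw [sub_zero, abs_of_nonneg hδ] at this
  exact this

lemma Phi_bdd {d : ℕ} {b : EE d → ℝ} {A : ℝ} (hA : ∀ x, |b x| ≤ A) (δ : ℝ) (hδ : 0 ≤ δ) (L : ℕ) (x : EE d) :
    |Phi b δ L x| ≤ L * ((A + A) * δ) := by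
  unfold Phi
  refine (Finset.abs_sum_le_sum_abs _ _).trans ?_
  refine (Finset.sum_le_sum fun m _ => gm_bdd hA δ hδ m x).trans ?_
  simp

lemma PT_Phi {d : ℕ} {b : EE d → ℝ} (hb : Measurable b) {A : ℝ} (hA : ∀ x, |b x| ≤ A) (δ : ℝ) (hδ : 0 ≤ δ) (L : ℕ)
    (x : EE d) : PT (Phi b δ L) δ x = Phi b δ (L + 1) x - gm b δ 0 x := by
  have : Phi b δ (L + 1) x - gm b δ 0 x = ∑ m ∈ Finset.range L, gm b δ (m + 1) x := by
    rw [Phi, Finset.sum_range_succ']; ring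
  rw [this, PT]
  unfold Phi
  rw [integral_finsetSum]
  · exact Finset.sum_congr rfl fun m _ => PT_gm hb hA δ hδ m x
  · exact fun m _ => PT_integrable (gm_meas hb δ hδ m) (gm_bdd hA δ hδ m) δ x

lemma Phi_est (d : ℕ) (ε : ℝ) (hε : 0 < ε) : ∃ C : ℝ, 0 < C ∧ ∀ (α : ℝ), 0 ≤ α → α ≤ 1 → ∀ (b : EE d → ℝ) (A H : ℝ), Measurable b →
    (∀ x, |b x| ≤ A) → 0 ≤ H → (∀ x y, |b x - b y| ≤ H * ‖x - y‖ ^ α) → ∀ δ : ℝ, 0 < δ → ∀ K : ℕ, 1 ≤ K →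
    (∀ x, |Phi b δ K x| ≤ C * (H * δ ^ (1 + α / 2)) * √K) ∧
    (∀ L < K, ∀ x y, |Phi b δ L x - Phi b δ (L + 1) y| ≤ C * (H * δ ^ (1 + α / 2) * (K:ℝ) ^ ε) * (1 + ‖x - y‖ / √δ)) := by
  obtain ⟨C1, hC1, h1⟩ := gm_bound d
  obtain ⟨C2, hC2, h2⟩ := gm_grad d
  refine ⟨(4 * C1 + 2 * C2) * (1 + 1 / ε) + 2 * C1, by positivity, ?_⟩
  intro α ha0 ha1 b A H hb hA hH hbH δ hδ K hK
  have h1' := h1 α ha0 ha1 b A H hb hA hH hbH δ hδ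
  have h2' := h2 α ha0 ha1 b A H hb hA hH hbH δ hδ
  set h := H * δ ^ (1 + α / 2) with hh
  have hh0 : 0 ≤ h := by positivity
  have hε1 : 0 ≤ 1 + 1 / ε := by positivity
  have hsq : 0 ≤ √(K:ℝ) := Real.sqrt_nonneg _
  constructor
  · intro x
    unfold Phi
    refine (Finset.abs_sum_le_sum_abs _ _).trans ?_
    refine (Finset.sum_le_sum fun m _ => h1' m x).trans ?_
    rw [← Finset.mul_sum]
    calc C1 * h * ∑ m ∈ Finset.range K, 1 / √((m:ℝ) + 1) ≤ C1 * h * (2 * √K) := by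
          gcongr; exact sum_inv_sqrt K
      _ = (2 * C1) * h * √K := by ring
      _ ≤ _ := by
          gcongr
          have : 0 ≤ (4 * C1 + 2 * C2) * (1 + 1 / ε) := by positivity
          linarith
  · intro L hL x y
    set V : ℝ := 1 + ‖x - y‖ / √δ with hV
    have hq : 0 ≤ ‖x - y‖ / √δ := div_nonneg (norm_nonneg _) (Real.sqrt_nonneg _)
    have hV1 : 1 ≤ V := by linarith
    have hK1 : (1:ℝ) ≤ K := by exact_mod_cast hK
    have hKε : 1 ≤ (K:ℝ) ^ ε := Real.one_le_rpow hK1 hε.le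
    have hb1 : ∀ m x, |gm b δ m x| ≤ C1 * h := by
      intro m x
      refine (h1' m x).trans ?_
      have : 1 / √((m:ℝ) + 1) ≤ 1 := by
        rw [div_le_one (Real.sqrt_pos.2 (by positivity))]
        exact Real.one_le_sqrt.2 (by linarith [Nat.cast_nonneg (α := ℝ) m])
      calc _ ≤ C1 * h * 1 := by gcongr
        _ = _ := mul_one _
    have key : ∀ m, |gm b δ m x - gm b δ m y| ≤ (4 * C1 + 2 * C2) * h * V * (1 / ((m:ℝ) + 1)) := by
      intro m
      have hCh : 0 ≤ C1 * h := by positivity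
      have hCh2 : 0 ≤ C2 * h := by positivity
      by_cases hm : 2 ≤ m
      · refine (h2' m hm x y).trans ?_
        have hm2 : (2:ℝ) ≤ m := by exact_mod_cast hm
        have e : 1 / (m:ℝ) ≤ 2 * (1 / ((m:ℝ) + 1)) := by
          rw [mul_one_div, div_le_div_iff₀ (by linarith) (by linarith)]; linarith
        have e2 : ‖x - y‖ / √δ ≤ V := by linarith
        calc C2 * h * (‖x - y‖ / √δ) * (1 / m) ≤ C2 * h * V * (2 * (1 / ((m:ℝ) + 1))) := by gcongr
          _ = (2 * C2) * h * V * (1 / ((m:ℝ) + 1)) := by ring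
          _ ≤ _ := by
            gcongr
            linarith
      · have hm1 : m ≤ 1 := by omega
        have hm2 : (m:ℝ) ≤ 1 := by exact_mod_cast hm1
        have e : (1:ℝ) ≤ 2 * (1 / ((m:ℝ) + 1)) := by
          rw [mul_one_div, le_div_iff₀ (by positivity)]; linarith
        calc |gm b δ m x - gm b δ m y| ≤ |gm b δ m x| + |gm b δ m y| := abs_sub _ _
          _ ≤ C1 * h + C1 * h := add_le_add (hb1 m x) (hb1 m y)
          _ = (2 * C1) * h * 1 * 1 := by ring
          _ ≤ (2 * C1) * h * V * (2 * (1 / ((m:ℝ) + 1))) := by gcongr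
          _ = (4 * C1) * h * V * (1 / ((m:ℝ) + 1)) := by ring
          _ ≤ _ := by
            gcongr
            linarith
    have e0 : Phi b δ L x - Phi b δ (L + 1) y = ∑ m ∈ Finset.range L, (gm b δ m x - gm b δ m y) - gm b δ L y := by
      rw [Phi, Phi, Finset.sum_range_succ, Finset.sum_sub_distrib]; ring
    rw [e0]
    calc |∑ m ∈ Finset.range L, (gm b δ m x - gm b δ m y) - gm b δ L y|
        ≤ |∑ m ∈ Finset.range L, (gm b δ m x - gm b δ m y)| + |gm b δ L y| := abs_sub _ _
      _ ≤ ∑ m ∈ Finset.range L, (4 * C1 + 2 * C2) * h * V * (1 / ((m:ℝ) + 1)) + C1 * h := by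
          gcongr
          · exact (Finset.abs_sum_le_sum_abs _ _).trans (Finset.sum_le_sum fun m _ => key m)
          · exact hb1 L y
      _ = (4 * C1 + 2 * C2) * h * V * ∑ m ∈ Finset.range L, (1 / ((m:ℝ) + 1)) + C1 * h * 1 * 1 := by
          rw [← Finset.mul_sum]; ring
      _ ≤ (4 * C1 + 2 * C2) * h * V * ((1 + 1 / ε) * (K:ℝ) ^ ε) + (2 * C1) * h * V * (K:ℝ) ^ ε := by
          gcongr ?_ * ?_ + ?_
          · exact sum_inv ε hε L K hL.le hK
          · gcongr
            linarith
      _ = _ := by ring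


section BM2
set_option linter.unusedSectionVars false
variable {Ω : Type} [m0 : MeasurableSpace Ω] {P : Measure Ω} [IsProbabilityMeasure P]
  {ℱ : ℝ → MeasurableSpace Ω} {d : ℕ} {B : ℝ → Ω → EE d}

/-- the integral over one cell -/
noncomputable def ZZ (b : EE d → ℝ) (B : ℝ → Ω → EE d) (δ T : ℝ) (ω : Ω) : ℝ :=
  ∫ ρ in (0:ℝ)..δ, (b (B (T + ρ) ω) - b (B T ω))

lemma swap_gen (Y : Ω → ℝ) (hYi : Integrable Y P) (hY : Measurable Y) (g : ℝ → Ω → ℝ) (hg : Measurable (Function.uncurry g))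
    (A : ℝ) (hA : ∀ r ω, |g r ω| ≤ A) (δ : ℝ) (hδ : 0 ≤ δ) :
    ∫ ω, Y ω * (∫ ρ in (0:ℝ)..δ, g ρ ω) ∂P = ∫ ρ in (0:ℝ)..δ, ∫ ω, Y ω * g ρ ω ∂P := by
  simp only [intervalIntegral.integral_of_le hδ, ← integral_const_mul]
  apply integral_integral_swap
  have h1 : Integrable (fun z : Ω × ℝ => ‖Y z.1‖ * (fun _ : ℝ => A) z.2) (P.prod (volume.restrict (Ioc 0 δ))) :=
    hYi.norm.mul_prod (integrable_const A)
  have hm : Measurable (fun z : Ω × ℝ => Y z.1 * g z.2 z.1) :=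
    (hY.comp measurable_fst).mul (hg.comp measurable_swap)
  refine Integrable.mono' h1 hm.aestronglyMeasurable (Filter.Eventually.of_forall fun z => ?_)
  simp only [Function.uncurry, norm_mul]
  exact mul_le_mul_of_nonneg_left (hA _ _) (norm_nonneg _)

lemma Z_mean (hB : IsBrownianMotion P ℱ B) (hle : ∀ t, ℱ t ≤ m0) (hBm : Measurable (Function.uncurry B))
    {b : EE d → ℝ} (hb : Measurable b) {A : ℝ} (hA : ∀ x, |b x| ≤ A) (δ T : ℝ) (hδ : 0 ≤ δ) (hT : 0 ≤ T) (hT1 : T + δ ≤ 1)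
    (Y : Ω → ℝ) (hY : Measurable[ℱ T] Y) (hYi : Integrable Y P) :
    ∫ ω, Y ω * ZZ b B δ T ω ∂P = ∫ ω, Y ω * gm b δ 0 (B T ω) ∂P := by
  have hY0 : Measurable Y := hY.mono (hle T) le_rfl
  have hBT : Measurable (B T) := bm_meas hB hle T hT (by linarith)
  have hg1 : Measurable (Function.uncurry (fun ρ ω => b (B (T + ρ) ω) - b (B T ω))) := by
    apply Measurable.sub
    · apply hb.comp
      exact hBm.comp ((measurable_const.add measurable_fst).prodMk measurable_snd)
    · exact hb.comp (hBT.comp measurable_snd)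
  have hg2 : Measurable (Function.uncurry (fun (ρ : ℝ) (ω : Ω) => PT b ((0:ℕ) * δ + ρ) (B T ω) - PT b ((0:ℕ) * δ) (B T ω))) := by
    apply Measurable.sub
    · exact (PT_meas hb).comp ((measurable_const.add measurable_fst).prodMk (hBT.comp measurable_snd))
    · exact (PT_meas1 hb _).comp (hBT.comp measurable_snd)
  unfold ZZ gm
  rw [swap_gen Y hYi hY0 _ hg1 (A + A) (fun r ω => (abs_sub _ _).trans (add_le_add (hA _) (hA _))) δ hδ,
    swap_gen Y hYi hY0 _ hg2 (A + A) (fun r ω => (abs_sub _ _).trans (add_le_add (PT_bdd hA _ _) (PT_bdd hA _ _))) δ hδ]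
  apply intervalIntegral.integral_congr
  intro ρ hρ
  rw [uIcc_of_le hδ] at hρ
  simp only [Nat.cast_zero, zero_mul, zero_add, PT_zero]
  have hi : ∀ f : Ω → ℝ, Measurable f → (∀ ω, |f ω| ≤ A) → Integrable (fun ω => Y ω * f ω) P := by
    intro f hf hfA
    refine Integrable.mono' (hYi.norm.mul_const A) (hY0.mul hf).aestronglyMeasurable
      (Filter.Eventually.of_forall fun ω => ?_)
    rw [norm_mul]
    exact mul_le_mul_of_nonneg_left (hfA _) (norm_nonneg _)
  have hBr : Measurable (B (T + ρ)) := bm_meas hB hle _ (by linarith [hρ.1]) (by linarith [hρ.2])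
  simp only [mul_sub]
  have j1 := hi _ (hb.comp hBr) (fun ω => hA _)
  have j2 := hi _ (hb.comp hBT) (fun ω => hA _)
  have j3 := hi _ ((PT_meas1 hb ρ).comp hBT) (fun ω => PT_bdd hA _ _)
  simp only [Function.comp] at j1 j2 j3
  rw [integral_sub j1 j2, integral_sub j3 j2]
  congr 1
  have := bm_cond hB hle T (T + ρ) hT (by linarith [hρ.1]) (by linarith [hρ.2]) Y hY hYi b hb A hA
  rw [add_sub_cancel_left] at this
  exact this

lemma Z_adapted (hB : IsBrownianMotion P ℱ B) (hmono : Monotone ℱ) (hBc : ∀ ω, Continuous (fun r => B r ω))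
    {b : EE d → ℝ} (hb : Measurable b) (δ T : ℝ) (hδ : 0 ≤ δ) (hT : 0 ≤ T) (hT1 : T + δ ≤ 1) :
    Measurable[ℱ (T + δ)] (ZZ b B δ T) := by
  have := @adapt_gen Ω (ℱ (T + δ)) d (fun r ω => B (max 0 (min (T + r) (T + δ))) ω)
    (fun ω => (hBc ω).comp (by fun_prop))
    (fun r => (hB.adapted _ (le_max_left _ _) (max_le zero_le_one ((min_le_right _ _).trans hT1))).mono
      (hmono (max_le (by linarith) (min_le_right _ _))) le_rfl) b hb δ hδ
  have e : ZZ b B δ T = fun ω => ∫ ρ in (0:ℝ)..δ, (b (B (max 0 (min (T + ρ) (T + δ))) ω) - b (B (max 0 (min (T + 0) (T + δ))) ω)) := by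
    funext ω
    apply intervalIntegral.integral_congr
    intro ρ hρ
    rw [uIcc_of_le hδ] at hρ
    have e1 : max 0 (min (T + ρ) (T + δ)) = T + ρ := by
      rw [min_eq_left (by linarith [hρ.2]), max_eq_right (by linarith [hρ.1])]
    have e2 : max 0 (min (T + 0) (T + δ)) = T := by
      rw [add_zero, min_eq_left (by linarith), max_eq_right hT]
    simp only [e1, e2]
  rw [e]
  exact this

lemma Z_mom (hB : IsBrownianMotion P ℱ B) (hle : ∀ t, ℱ t ≤ m0) (hBm : Measurable (Function.uncurry B))
    {b : EE d → ℝ} (hb : Measurable b) {H α : ℝ} (hH : 0 ≤ H) (h0 : 0 ≤ α) (h1 : α ≤ 1)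
    (hbH : ∀ x y, |b x - b y| ≤ H * ‖x - y‖ ^ α) (δ T : ℝ) (hδ : 0 < δ) (hT : 0 ≤ T) (hT1 : T + δ ≤ 1)
    (Y : Ω → ENNReal) (hY : Measurable[ℱ T] Y) (l : ℕ) :
    ∫⁻ ω, Y ω * ‖ZZ b B δ T ω‖ₑ ^ l ∂P ≤ ENNReal.ofReal (H * δ ^ (1 + α / 2)) ^ l * ENNReal.ofReal (Gl d l) * ∫⁻ ω, Y ω ∂P := by
  rcases l with _ | m
  · simp only [pow_zero, mul_one, one_mul]
    have : (1:ENNReal) ≤ ENNReal.ofReal (Gl d 0) := by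
      rw [← ENNReal.ofReal_one]; exact ENNReal.ofReal_le_ofReal (Gl_one d 0)
    exact le_mul_of_one_le_left' this
  have hBT : Measurable (B T) := bm_meas hB hle T hT (by linarith)
  have hg1 : Measurable (Function.uncurry (fun ρ ω => b (B (T + ρ) ω) - b (B T ω))) := by
    apply Measurable.sub
    · apply hb.comp
      exact hBm.comp ((measurable_const.add measurable_fst).prodMk measurable_snd)
    · exact hb.comp (hBT.comp measurable_snd)
  have := fub_pow P 0 δ hδ.le _ hg1 m Y (hY.mono (hle T) le_rfl) _ (fun r hr =>
    bm_R hB hle hH h0 h1 hbH δ T (T + r) hδ hT (by linarith [hr.1]) (by linarith [hr.2]) (by linarith [hr.2]) Y hY (m + 1))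
  refine this.trans (le_of_eq ?_)
  rw [sub_zero, ← mul_assoc, ← mul_pow, ← ENNReal.ofReal_mul hδ.le, Real.rpow_add hδ, Real.rpow_one]
  congr 4
  ring

/-- the martingale differences -/
noncomputable def DD (b : EE d → ℝ) (B : ℝ → Ω → EE d) (δ T : ℝ) (L : ℕ) (ω : Ω) : ℝ :=
  ZZ b B δ T ω + Phi b δ L (B (T + δ) ω) - Phi b δ (L + 1) (B T ω)

lemma D_mean (hB : IsBrownianMotion P ℱ B) (hle : ∀ t, ℱ t ≤ m0) (hmono : Monotone ℱ)
    (hBc : ∀ ω, Continuous (fun r => B r ω)) (hBm : Measurable (Function.uncurry B))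
    {b : EE d → ℝ} (hb : Measurable b) {A : ℝ} (hA : ∀ x, |b x| ≤ A) (δ T : ℝ) (hδ : 0 ≤ δ) (hT : 0 ≤ T) (hT1 : T + δ ≤ 1)
    (L : ℕ) (Y : Ω → ℝ) (hY : Measurable[ℱ T] Y) (hYi : Integrable Y P) :
    ∫ ω, Y ω * DD b B δ T L ω ∂P = 0 := by
  have hY0 : Measurable Y := hY.mono (hle T) le_rfl
  have hBT : Measurable (B T) := bm_meas hB hle T hT (by linarith)
  have hBT' : Measurable (B (T + δ)) := bm_meas hB hle (T + δ) (by linarith) hT1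
  have hi : ∀ (f : Ω → ℝ) (A : ℝ), Measurable f → (∀ ω, |f ω| ≤ A) → Integrable (fun ω => Y ω * f ω) P := by
    intro f A hf hfA
    refine Integrable.mono' (hYi.norm.mul_const A) (hY0.mul hf).aestronglyMeasurable
      (Filter.Eventually.of_forall fun ω => ?_)
    rw [norm_mul]
    exact mul_le_mul_of_nonneg_left (hfA _) (norm_nonneg _)
  have hZm : Measurable (ZZ b B δ T) := (Z_adapted hB hmono hBc hb δ T hδ hT hT1).mono (hle _) le_rfl
  have hZb : ∀ ω, |ZZ b B δ T ω| ≤ (A + A) * δ := by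
    intro ω
    have := intervalIntegral.norm_integral_le_of_norm_le_const (a := 0) (b := δ) (C := A + A)
      (f := fun ρ => b (B (T + ρ) ω) - b (B T ω))
      (fun ρ _ => (norm_sub_le _ _).trans (add_le_add (hA _) (hA _)))
    rw [sub_zero, abs_of_nonneg hδ] at this
    exact this
  have i1 := hi _ _ hZm hZb
  have i2 := hi _ _ ((Phi_meas hb δ hδ L).comp hBT') (fun ω => Phi_bdd hA δ hδ L _)
  have i3 := hi _ _ ((Phi_meas hb δ hδ (L + 1)).comp hBT) (fun ω => Phi_bdd hA δ hδ (L + 1) _)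
  have i4 := hi _ _ ((gm_meas hb δ hδ 0).comp hBT) (fun ω => gm_bdd hA δ hδ 0 _)
  simp only [Function.comp] at i2 i3 i4
  have e := bm_cond hB hle T (T + δ) hT (by linarith) hT1 Y hY hYi (Phi b δ L) (Phi_meas hb δ hδ L) _ (Phi_bdd hA δ hδ L)
  rw [add_sub_cancel_left] at e
  simp only [PT_Phi hb hA δ hδ L, mul_sub] at e
  rw [integral_sub i3 i4] at e
  unfold DD
  simp only [mul_sub, mul_add]
  have i12 : Integrable (fun ω => Y ω * ZZ b B δ T ω + Y ω * Phi b δ L (B (T + δ) ω)) P := i1.add i2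
  rw [integral_sub i12 i3, integral_add i1 i2, e, Z_mean hB hle hBm hb hA δ T hδ hT hT1 Y hY hYi]
  ring

end BM2


lemma mid_est (d : ℕ) (ε : ℝ) (hε : 0 < ε) (M : ℕ) (hM : 1 ≤ M) : ∃ C : ℝ, 0 < C ∧
    ∀ (Ω : Type) [m0 : MeasurableSpace Ω] (P : Measure Ω) [IsProbabilityMeasure P]
      (ℱ : ℝ → MeasurableSpace Ω) (B : ℝ → Ω → EE d), IsBrownianMotion P ℱ B → (∀ t, ℱ t ≤ m0) → Monotone ℱ →
      (∀ ω, Continuous (fun r => B r ω)) → Measurable (Function.uncurry B) →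
    ∀ (α : ℝ), 0 ≤ α → α ≤ 1 → ∀ (b : EE d → ℝ) (A H : ℝ), Measurable b →
    (∀ x, |b x| ≤ A) → 0 < H → (∀ x y, |b x - b y| ≤ H * ‖x - y‖ ^ α) → ∀ δ : ℝ, 0 < δ → ∀ i K : ℕ, 1 ≤ K →
    ((i:ℝ) + K) * δ ≤ 1 →
    eLpNorm (fun ω => ∑ k ∈ Finset.range K, ZZ b B δ ((i + k) * δ) ω) ((2 * M : ℕ) : ENNReal) P
      ≤ ENNReal.ofReal (C * (H * δ ^ (1 + α / 2) * (K:ℝ) ^ ε * √K)) := by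
  obtain ⟨C3, hC3, hPhi⟩ := Phi_est d ε hε
  have hGl : ∀ l, 0 ≤ Gl d l := fun l => zero_le_one.trans (Gl_one d l)
  obtain ⟨a, ha, hmart⟩ := mart_moment (fun l => 2 ^ l * ((1 + C3 ^ l) * Gl d l))
    (fun l => mul_nonneg (by positivity) (mul_nonneg (by positivity) (hGl l))) M
  refine ⟨(a + 1) + C3, by positivity, ?_⟩
  intro Ω m0 P hP ℱ B hB hle hmono hBc hBm α ha0 ha1 b A H hb hA hH hbH δ hδ i K hK hiK
  obtain ⟨hPhi1, hPhi2⟩ := hPhi α ha0 ha1 b A H hb hA hH.le hbH δ hδ K hK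
  set h := H * δ ^ (1 + α / 2) with hh
  have hh0 : 0 < h := by positivity
  have hK1 : (1:ℝ) ≤ K := by exact_mod_cast hK
  have hKε : 1 ≤ (K:ℝ) ^ ε := Real.one_le_rpow hK1 hε.le
  set c := h * (K:ℝ) ^ ε with hc
  have hc0 : 0 < c := by positivity
  have hhc : h ≤ c := by rw [hc]; nlinarith
  -- grid
  set T : ℕ → ℝ := fun k => (i + k) * δ with hT
  have hT0 : ∀ k, 0 ≤ T k := fun k => by simp only [hT]; positivity
  have hTs : ∀ k, T (k + 1) = T k + δ := fun k => by simp only [hT]; push_cast; ring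
  have hT1 : ∀ k < K, T k + δ ≤ 1 := by
    intro k hk
    have : (k:ℝ) + 1 ≤ K := by exact_mod_cast hk
    refine le_trans ?_ hiK
    rw [← hTs]
    simp only [hT]
    push_cast
    apply mul_le_mul_of_nonneg_right _ hδ.le
    linarith
  have hTK : ∀ k ≤ K, T k ≤ 1 := by
    intro k hk
    have : (k:ℝ) ≤ K := by exact_mod_cast hk
    refine le_trans ?_ hiK
    simp only [hT]
    apply mul_le_mul_of_nonneg_right _ hδ.le
    linarith
  set D : ℕ → Ω → ℝ := fun k ω => c⁻¹ * DD b B δ (T k) (K - k - 1) ω with hD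
  set S : ℕ → Ω → ℝ := fun k ω => ∑ j ∈ Finset.range k, D j ω with hS
  have hDad : ∀ k < K, Measurable[ℱ (T (k + 1))] (D k) := by
    intro k hk
    have e1 := Z_adapted hB hmono hBc hb δ (T k) hδ.le (hT0 k) (hT1 k hk)
    have e2 := hB.adapted (T k + δ) (by linarith [hT0 k]) (hT1 k hk)
    have e3 := (hB.adapted (T k) (hT0 k) (by linarith [hT1 k hk])).mono (hmono (by linarith : T k ≤ T k + δ)) le_rfl
    rw [hTs]
    exact Measurable.const_mul ((e1.add ((Phi_meas hb δ hδ.le _).comp e2)).sub ((Phi_meas hb δ hδ.le _).comp e3)) _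
  have hDm : ∀ k < K, Measurable (D k) := fun k hk => (hDad k hk).mono (hle _) le_rfl
  have hTmono : ∀ j k, j ≤ k → T j ≤ T k := by
    intro j k hjk
    have : (j:ℝ) ≤ k := by exact_mod_cast hjk
    simp only [hT]
    apply mul_le_mul_of_nonneg_right _ hδ.le
    linarith
  have hres := hmart Ω P K (fun k => ℱ (T k)) S D (fun k => hle _) (fun ω => by simp [hS])
    (fun k _ ω => by simp only [hS]; rw [Finset.sum_range_succ])
    (fun k hk => by
      simp only [hS]
      refine @Finset.measurable_fun_sum _ _ _ _ _ _ (ℱ (T k)) _ _ fun j hj => ?_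
      have hj' : j < k := Finset.mem_range.1 hj
      exact (hDad j (by omega)).mono (hmono (hTmono _ _ hj')) le_rfl)
    hDm
    (fun k hk l Y hY => by
      have hVm := bm_V hB hle δ (T k) (T k + δ) hδ (hT0 k) (by linarith) (hT1 k hk) le_rfl Y hY l
      have hZm := Z_mom hB hle hBm hb hH.le ha0 ha1 hbH δ (T k) hδ (hT0 k) (hT1 k hk) Y hY l
      have pt : ∀ ω, ‖D k ω‖ₑ ≤ ENNReal.ofReal c⁻¹ * ‖ZZ b B δ (T k) ω‖ₑ
          + ENNReal.ofReal C3 * ENNReal.ofReal (1 + ‖B (T k + δ) ω - B (T k) ω‖ / √δ) := by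
        intro ω
        have e := hPhi2 (K - k - 1) (by omega) (B (T k + δ) ω) (B (T k) ω)
        have hV0 : 0 ≤ 1 + ‖B (T k + δ) ω - B (T k) ω‖ / √δ :=
          add_nonneg zero_le_one (div_nonneg (norm_nonneg _) (Real.sqrt_nonneg _))
        rw [← ofReal_norm, ← ofReal_norm, ← ENNReal.ofReal_mul (inv_nonneg.2 hc0.le), ← ENNReal.ofReal_mul hC3.le,
          ← ENNReal.ofReal_add (mul_nonneg (inv_nonneg.2 hc0.le) (norm_nonneg _)) (mul_nonneg hC3.le hV0)]
        apply ENNReal.ofReal_le_ofReal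
        simp only [hD]
        rw [norm_mul, Real.norm_of_nonneg (inv_nonneg.2 hc0.le), DD, add_sub_assoc]
        calc _ ≤ c⁻¹ * (‖ZZ b B δ (T k) ω‖ + C3 * c * (1 + ‖B (T k + δ) ω - B (T k) ω‖ / √δ)) := by
              apply mul_le_mul_of_nonneg_left _ (inv_nonneg.2 hc0.le)
              exact (norm_add_le _ _).trans (add_le_add le_rfl e)
          _ = _ := by
              field_simp
      calc ∫⁻ ω, Y ω * ‖D k ω‖ₑ ^ l ∂P
          ≤ ∫⁻ ω, (2 ^ l * ENNReal.ofReal c⁻¹ ^ l) * (Y ω * ‖ZZ b B δ (T k) ω‖ₑ ^ l) +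
            (2 ^ l * ENNReal.ofReal C3 ^ l) * (Y ω * ENNReal.ofReal (1 + ‖B (T k + δ) ω - B (T k) ω‖ / √δ) ^ l) ∂P := by
            apply lintegral_mono
            intro ω
            simp only
            calc Y ω * ‖D k ω‖ₑ ^ l ≤ Y ω * (2 ^ l * ((ENNReal.ofReal c⁻¹ * ‖ZZ b B δ (T k) ω‖ₑ) ^ l
              + (ENNReal.ofReal C3 * ENNReal.ofReal (1 + ‖B (T k + δ) ω - B (T k) ω‖ / √δ)) ^ l)) := by
                  gcongr
                  exact (pow_le_pow_left' (pt ω) l).trans (ennreal_add_pow _ _ _)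
              _ = _ := by rw [mul_pow, mul_pow]; ring
        _ = (2 ^ l * ENNReal.ofReal c⁻¹ ^ l) * ∫⁻ ω, (Y ω * ‖ZZ b B δ (T k) ω‖ₑ ^ l) ∂P +
            (2 ^ l * ENNReal.ofReal C3 ^ l) * ∫⁻ ω, (Y ω * ENNReal.ofReal (1 + ‖B (T k + δ) ω - B (T k) ω‖ / √δ) ^ l) ∂P := by
            have hY0 : Measurable Y := hY.mono (hle _) le_rfl
            have hZ0 : Measurable (ZZ b B δ (T k)) :=
              (Z_adapted hB hmono hBc hb δ (T k) hδ.le (hT0 k) (hT1 k hk)).mono (hle _) le_rfl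
            rw [lintegral_add_left (by fun_prop), lintegral_const_mul', lintegral_const_mul']
            · exact ENNReal.mul_ne_top (by simp) (by simp)
            · exact ENNReal.mul_ne_top (by simp) (by simp)
        _ ≤ (2 ^ l * ENNReal.ofReal c⁻¹ ^ l) * (ENNReal.ofReal c ^ l * ENNReal.ofReal (Gl d l) * ∫⁻ ω, Y ω ∂P) +
            (2 ^ l * ENNReal.ofReal C3 ^ l) * (ENNReal.ofReal (Gl d l) * ∫⁻ ω, Y ω ∂P) := by
            gcongr
            refine hZm.trans ?_
            gcongr
        _ = _ := by
            have e1 : ENNReal.ofReal c⁻¹ ^ l * ENNReal.ofReal c ^ l = 1 := by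
              rw [← mul_pow, ← ENNReal.ofReal_mul (inv_nonneg.2 hc0.le), inv_mul_cancel₀ hc0.ne']; simp
            have e2 : ENNReal.ofReal (2 ^ l * ((1 + C3 ^ l) * Gl d l)) = 2 ^ l * ((1 + ENNReal.ofReal C3 ^ l) * ENNReal.ofReal (Gl d l)) := by
              rw [ENNReal.ofReal_mul (by positivity), ENNReal.ofReal_mul (by positivity), ENNReal.ofReal_add zero_le_one (by positivity),
                ENNReal.ofReal_pow (by norm_num), ENNReal.ofReal_pow hC3.le]
              simp
            rw [e2]
            calc _ = 2 ^ l * (ENNReal.ofReal c⁻¹ ^ l * ENNReal.ofReal c ^ l) * (ENNReal.ofReal (Gl d l) * ∫⁻ ω, Y ω ∂P) +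
                  (2 ^ l * ENNReal.ofReal C3 ^ l) * (ENNReal.ofReal (Gl d l) * ∫⁻ ω, Y ω ∂P) := by ring
              _ = _ := by rw [e1]; ring)
    (fun k hk Y hY hYi => by
      have := D_mean hB hle hmono hBc hBm hb hA δ (T k) hδ.le (hT0 k) (hT1 k hk) (K - k - 1) Y hY hYi
      simp only [hD, mul_left_comm _ (c⁻¹)]
      rw [integral_const_mul, this, mul_zero])
    K le_rfl
  obtain ⟨hSi, hSle⟩ := hres
  have hSm : Measurable (S K) := by
    simp only [hS]
    exact Finset.measurable_fun_sum _ fun j hj => hDm j (Finset.mem_range.1 hj)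
  have tele : ∀ ω, ∑ k ∈ Finset.range K, ZZ b B δ ((i + k) * δ) ω = c * S K ω + Phi b δ K (B (T 0) ω) := by
    intro ω
    have e1 : ∀ k ≤ K, c * S k ω = ∑ j ∈ Finset.range k, ZZ b B δ (T j) ω + Phi b δ (K - k) (B (T k) ω) - Phi b δ K (B (T 0) ω) := by
      intro k
      induction k with
      | zero => intro _; simp [hS]
      | succ k ih =>
        intro hk
        have e2 : S (k + 1) ω = S k ω + D k ω := by simp only [hS]; rw [Finset.sum_range_succ]
        rw [e2, mul_add, ih (by omega), Finset.sum_range_succ]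
        simp only [hD]
        rw [mul_inv_cancel_left₀ hc0.ne', DD, hTs, show K - k - 1 + 1 = K - k by omega, show K - (k + 1) = K - k - 1 by omega]
        ring
    have := e1 K le_rfl
    rw [this, Nat.sub_self]
    simp [Phi, hT]
  have hM0 : (2 * M : ℕ) ≠ 0 := by omega
  have n1 : eLpNorm (S K) ((2 * M : ℕ) : ENNReal) P ≤ ENNReal.ofReal ((a + 1) * √K) := by
    rw [eLpNorm_eq_lintegral_rpow_enorm_toReal (by exact_mod_cast hM0) (ENNReal.natCast_ne_top _)]
    simp only [ENNReal.toReal_natCast, ENNReal.rpow_natCast]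
    have e1 : ∫⁻ ω, ‖S K ω‖ₑ ^ (2 * M) ∂P = ENNReal.ofReal (∫ ω, S K ω ^ (2 * M) ∂P) := by
      rw [ofReal_integral_eq_lintegral_ofReal hSi (Filter.Eventually.of_forall fun ω => by
        simp only [Pi.zero_apply]; rw [pow_mul]; positivity)]
      congr 1
      funext ω
      rw [← enorm_pow, Real.enorm_of_nonneg]
      rw [pow_mul]; positivity
    rw [e1]
    have hM2 : (0:ℝ) < ((2 * M : ℕ) : ℝ) := by positivity
    have e2 : (a * (K:ℝ) ^ M) ≤ ((a + 1) * √K) ^ (2 * M) := by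
      rw [mul_pow, pow_mul (√(K:ℝ)), Real.sq_sqrt (by positivity)]
      gcongr
      calc a ≤ a + 1 := by linarith
        _ ≤ (a + 1) ^ (2 * M) := le_self_pow₀ (by linarith) hM0
    calc ENNReal.ofReal (∫ ω, S K ω ^ (2 * M) ∂P) ^ (1 / ((2 * M : ℕ) : ℝ))
        ≤ ENNReal.ofReal (((a + 1) * √K) ^ (2 * M)) ^ (1 / ((2 * M : ℕ) : ℝ)) := by
          gcongr
          exact hSle.trans e2
      _ = _ := by
          rw [ENNReal.ofReal_pow (by positivity), ← ENNReal.rpow_natCast, ← ENNReal.rpow_mul, mul_one_div_cancel hM2.ne', ENNReal.rpow_one]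
  have hBT : Measurable (B (T 0)) := bm_meas hB hle _ (hT0 0) (hTK 0 (by omega))
  have n2 : eLpNorm (fun ω => Phi b δ K (B (T 0) ω)) ((2 * M : ℕ) : ENNReal) P ≤ ENNReal.ofReal (C3 * h * √K) := by
    refine (eLpNorm_le_of_ae_bound (C := C3 * h * √K) (Filter.Eventually.of_forall fun ω => hPhi1 _)).trans ?_
    simp
  have e3 : (fun ω => ∑ k ∈ Finset.range K, ZZ b B δ ((i + k) * δ) ω) = (c • S K) + (fun ω => Phi b δ K (B (T 0) ω)) := by
    funext ω
    rw [tele]; simp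
  rw [e3]
  refine (eLpNorm_add_le (hSm.const_smul c).aestronglyMeasurable ((Phi_meas hb δ hδ.le K).comp hBT).aestronglyMeasurable
    (by exact_mod_cast (by omega : 1 ≤ 2 * M))).trans ?_
  rw [eLpNorm_const_smul]
  calc _ ≤ ENNReal.ofReal c * ENNReal.ofReal ((a + 1) * √K) + ENNReal.ofReal (C3 * h * √K) := by
        exact add_le_add (mul_le_mul' (by rw [Real.enorm_of_nonneg hc0.le]) n1) n2
    _ ≤ _ := by
        rw [← ENNReal.ofReal_mul hc0.le, ← ENNReal.ofReal_add (by positivity) (by positivity)]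
        apply ENNReal.ofReal_le_ofReal
        have : C3 * h * √K ≤ C3 * c * √K := by gcongr
        calc _ ≤ c * ((a + 1) * √K) + C3 * c * √K := by linarith
          _ = _ := by ring


lemma kappa_meas (n : ℕ) : Measurable (kappa n) := by
  unfold kappa
  have : Measurable (fun t : ℝ => (n:ℝ) * t) := by fun_prop
  have h2 : Measurable (fun t : ℝ => ⌊(n:ℝ) * t⌋) := Int.measurable_floor.comp this
  have h3 : Measurable (fun t : ℝ => ((⌊(n:ℝ) * t⌋ : ℤ) : ℝ)) := (measurable_from_top (f := fun z : ℤ => (z:ℝ))).comp h2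
  exact h3.div_const _

lemma kappa_nonneg (n : ℕ) (t : ℝ) (ht : 0 ≤ t) : 0 ≤ kappa n t := by
  unfold kappa
  have : (0:ℤ) ≤ ⌊(n:ℝ) * t⌋ := Int.floor_nonneg.2 (by positivity)
  have : (0:ℝ) ≤ (⌊(n:ℝ) * t⌋ : ℝ) := by exact_mod_cast this
  positivity

lemma kappa_le (n : ℕ) (hn : 1 ≤ n) (t : ℝ) : kappa n t ≤ t := by
  unfold kappa
  have hn' : (0:ℝ) < n := by exact_mod_cast hn
  rw [div_le_iff₀ hn', mul_comm]
  exact Int.floor_le _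

lemma le_kappa_add (n : ℕ) (hn : 1 ≤ n) (t : ℝ) : t ≤ kappa n t + 1 / n := by
  unfold kappa
  have hn' : (0:ℝ) < n := by exact_mod_cast hn
  rw [← add_div, le_div_iff₀ hn', mul_comm]
  exact (Int.lt_floor_add_one _).le

lemma kappa_cell (n : ℕ) (hn : 1 ≤ n) (m : ℕ) (ρ : ℝ) (h0 : 0 ≤ ρ) (h1 : ρ < 1 / n) :
    kappa n (m * (1 / n) + ρ) = m * (1 / n) := by
  unfold kappa
  have hn' : (0:ℝ) < n := by exact_mod_cast hn
  have : ⌊(n:ℝ) * (m * (1 / n) + ρ)⌋ = (m:ℤ) := by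
    rw [Int.floor_eq_iff]
    have e : (n:ℝ) * (m * (1 / n) + ρ) = m + n * ρ := by field_simp
    rw [e]
    rw [lt_div_iff₀ hn'] at h1
    push_cast
    constructor
    · have : 0 ≤ (n:ℝ) * ρ := by positivity
      linarith
    · linarith
  rw [this]
  push_cast
  ring

section
variable {Ω : Type} [m0 : MeasurableSpace Ω] {P : Measure Ω} [IsProbabilityMeasure P]
  {ℱ : ℝ → MeasurableSpace Ω} {d : ℕ} {B : ℝ → Ω → EE d}

/-- the integrand -/
noncomputable def XX (n : ℕ) (b : EE d → ℝ) (B : ℝ → Ω → EE d) (r : ℝ) (ω : Ω) : ℝ :=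
  b (B r ω) - b (B (kappa n r) ω)

lemma XX_meas (n : ℕ) {b : EE d → ℝ} (hb : Measurable b) (hBm : Measurable (Function.uncurry B)) :
    Measurable (Function.uncurry (XX n b B)) := by
  have h1 : Measurable (fun q : ℝ × Ω => b (Function.uncurry B q)) := hb.comp hBm
  have h2 : Measurable (fun q : ℝ × Ω => b (Function.uncurry B (kappa n q.1, q.2))) :=
    hb.comp (hBm.comp (((kappa_meas n).comp measurable_fst).prodMk measurable_snd))
  exact h1.sub h2

lemma XX_int (n : ℕ) {b : EE d → ℝ} {A : ℝ} (hb : Measurable b) (hA : ∀ x, |b x| ≤ A) (hBm : Measurable (Function.uncurry B))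
    (ω : Ω) (u v : ℝ) : IntervalIntegrable (fun r => XX n b B r ω) volume u v := by
  have h1 : Measurable (fun r => XX n b B r ω) := (XX_meas n hb hBm).comp (measurable_id.prodMk measurable_const)
  refine (intervalIntegrable_const (c := 2 * A)).mono_fun h1.aestronglyMeasurable (Filter.Eventually.of_forall fun r => ?_)
  simp only [Real.norm_eq_abs]
  refine le_trans ?_ (le_abs_self _)
  unfold XX
  have := abs_sub (b (B r ω)) (b (B (kappa n r) ω))
  linarith [hA (B r ω), hA (B (kappa n r) ω)]

lemma XXI_meas (n : ℕ) {b : EE d → ℝ} (hb : Measurable b) (hBm : Measurable (Function.uncurry B)) (u v : ℝ) :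
    Measurable (fun ω => ∫ r in u..v, XX n b B r ω) := by
  have h := (XX_meas n hb hBm).comp measurable_swap
  have h2 : StronglyMeasurable (fun q : Ω × ℝ => XX n b B q.2 q.1) := h.stronglyMeasurable
  simp only [intervalIntegral]
  exact (h2.integral_prod_right (ν := volume.restrict (Ioc u v))).measurable.sub
    (h2.integral_prod_right (ν := volume.restrict (Ioc v u))).measurable

lemma triv_est (hB : IsBrownianMotion P ℱ B) (hle : ∀ t, ℱ t ≤ m0) (hBm : Measurable (Function.uncurry B))
    {b : EE d → ℝ} {H α : ℝ} (hb : Measurable b) (hH : 0 ≤ H) (h0 : 0 ≤ α) (h1 : α ≤ 1)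
    (hbH : ∀ x y, |b x - b y| ≤ H * ‖x - y‖ ^ α) (n : ℕ) (hn : 1 ≤ n) (M : ℕ) (hM : 1 ≤ M)
    (s t : ℝ) (hs : 0 ≤ s) (hst : s ≤ t) (ht : t ≤ 1) :
    eLpNorm (fun ω => ∫ r in s..t, XX n b B r ω) ((2 * M : ℕ) : ENNReal) P ≤
      ENNReal.ofReal (Gl d (2 * M) * ((t - s) * (H * (1 / (n:ℝ)) ^ (α / 2)))) := by
  have hM0 : (2 * M : ℕ) ≠ 0 := by omega
  have hn' : (0:ℝ) < 1 / n := by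
    have : (0:ℝ) < n := by exact_mod_cast hn
    positivity
  have hM2 : (0:ℝ) < ((2 * M : ℕ) : ℝ) := by
    have : 0 < 2 * M := by omega
    exact_mod_cast this
  have hG := Gl_one d (2 * M)
  have hc : 0 ≤ H * (1 / (n:ℝ)) ^ (α / 2) := mul_nonneg hH (Real.rpow_nonneg hn'.le _)
  rw [eLpNorm_eq_lintegral_rpow_enorm_toReal (by exact_mod_cast hM0) (ENNReal.natCast_ne_top _)]
  simp only [ENNReal.toReal_natCast, ENNReal.rpow_natCast]
  have key := fub_pow P s t hst (XX n b B) (XX_meas n hb hBm) (2 * M - 1) (fun _ => 1) measurable_const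
    (ENNReal.ofReal (H * (1 / (n:ℝ)) ^ (α / 2)) ^ (2 * M) * ENNReal.ofReal (Gl d (2 * M))) (by
      intro r hr
      rw [show 2 * M - 1 + 1 = 2 * M by omega]
      exact bm_R hB hle hH h0 h1 hbH (1 / n) (kappa n r) r hn' (kappa_nonneg n r (by linarith [hr.1]))
        (kappa_le n hn r) (hr.2.trans ht) (le_kappa_add n hn r) (fun _ => 1) measurable_const (2 * M))
  rw [show 2 * M - 1 + 1 = 2 * M by omega] at key
  simp only [one_mul, lintegral_const, measure_univ, mul_one] at key
  have key2 : ∫⁻ ω, ‖∫ r in s..t, XX n b B r ω‖ₑ ^ (2 * M) ∂P ≤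
      ENNReal.ofReal (Gl d (2 * M) * ((t - s) * (H * (1 / (n:ℝ)) ^ (α / 2)))) ^ (2 * M) := by
    refine key.trans ?_
    generalize H * (1 / (n:ℝ)) ^ (α / 2) = c at hc ⊢
    rw [ENNReal.ofReal_mul (zero_le_one.trans hG), ENNReal.ofReal_mul (sub_nonneg.2 hst), mul_pow, mul_pow]
    have : ENNReal.ofReal (Gl d (2 * M)) ≤ ENNReal.ofReal (Gl d (2 * M)) ^ (2 * M) :=
      le_self_pow₀ (by rw [ENNReal.one_le_ofReal]; exact hG) hM0
    calc _ = ENNReal.ofReal (Gl d (2 * M)) * (ENNReal.ofReal (t - s) ^ (2 * M) * ENNReal.ofReal c ^ (2 * M)) := by ring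
      _ ≤ _ := by gcongr
  calc _ ≤ (ENNReal.ofReal (Gl d (2 * M) * ((t - s) * (H * (1 / (n:ℝ)) ^ (α / 2)))) ^ (2 * M)) ^ (1 / ((2 * M : ℕ) : ℝ)) := by
        gcongr
    _ = _ := by
        rw [← ENNReal.rpow_natCast, ← ENNReal.rpow_mul, mul_one_div_cancel hM2.ne', ENNReal.rpow_one]

lemma mid_eq (n : ℕ) (hn : 1 ≤ n) {b : EE d → ℝ} {A : ℝ} (hb : Measurable b) (hA : ∀ x, |b x| ≤ A)
    (hBm : Measurable (Function.uncurry B)) (i K : ℕ) (ω : Ω) :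
    ∫ r in ((i:ℝ) * (1 / n))..(((i + K : ℕ) : ℝ) * (1 / n)), XX n b B r ω =
      ∑ k ∈ Finset.range K, ZZ b B (1 / n) ((i + k) * (1 / n)) ω := by
  have hn' : (0:ℝ) < 1 / n := by
    have : (0:ℝ) < n := by exact_mod_cast hn
    positivity
  have := intervalIntegral.sum_integral_adjacent_intervals (f := fun r => XX n b B r ω) (μ := volume)
    (a := fun k : ℕ => ((i + k : ℕ) : ℝ) * (1 / n)) (n := K) (fun k _ => XX_int n hb hA hBm ω _ _)
  simp only [Nat.add_zero] at this
  rw [← this]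
  refine Finset.sum_congr rfl fun k _ => ?_
  rw [ZZ]
  have e1 : ((i + (k + 1) : ℕ) : ℝ) * (1 / (n:ℝ)) = ((i + k : ℕ) : ℝ) * (1 / n) + 1 / n := by push_cast; ring
  have e2 : ∫ r in (((i + k : ℕ) : ℝ) * (1 / n))..(((i + k : ℕ) : ℝ) * (1 / n) + 1 / n), XX n b B r ω =
     ∫ ρ in (0:ℝ)..(1 / n), XX n b B (((i + k : ℕ) : ℝ) * (1 / n) + ρ) ω := by
    rw [intervalIntegral.integral_comp_add_left (fun r => XX n b B r ω)]
    rw [add_zero]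
  rw [e1, e2]
  apply intervalIntegral.integral_congr_ae
  have : ∀ᵐ ρ : ℝ, ρ ≠ 1 / n := by simp [ae_iff]
  filter_upwards [this] with ρ h1 h2
  rw [uIoc_of_le hn'.le] at h2
  rw [XX, kappa_cell n hn _ ρ h2.1.le (lt_of_le_of_ne h2.2 h1)]
  push_cast
  rfl

end


lemma real_f1 (x δ L α ε : ℝ) (hx : 0 ≤ x) (hδ : 0 < δ) (hxd : x ≤ δ) (hxL : x ≤ L) (hε0 : 0 < ε) (hε1 : ε < 1 / 2) :
    x * δ ^ (α / 2) ≤ δ ^ (1 / 2 + α / 2 - ε) * L ^ (1 / 2 + ε) := by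
  have e : x = x ^ (1 / 2 - ε) * x ^ (1 / 2 + ε) := by
    rw [← Real.rpow_add_of_nonneg hx (by linarith) (by linarith)]
    norm_num
  have e2 : δ ^ (1 / 2 + α / 2 - ε) = δ ^ (1 / 2 - ε) * δ ^ (α / 2) := by
    rw [← Real.rpow_add hδ]; congr 1; ring
  have h1 : x ^ (1 / 2 - ε) ≤ δ ^ (1 / 2 - ε) := Real.rpow_le_rpow hx hxd (by linarith)
  have h2 : x ^ (1 / 2 + ε) ≤ L ^ (1 / 2 + ε) := Real.rpow_le_rpow hx hxL (by linarith)
  calc x * δ ^ (α / 2) = (x ^ (1 / 2 - ε) * x ^ (1 / 2 + ε)) * δ ^ (α / 2) := by rw [← e]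
    _ ≤ (δ ^ (1 / 2 - ε) * L ^ (1 / 2 + ε)) * δ ^ (α / 2) := by
        refine mul_le_mul_of_nonneg_right ?_ (Real.rpow_nonneg hδ.le _)
        exact mul_le_mul h1 h2 (Real.rpow_nonneg hx _) (Real.rpow_nonneg hδ.le _)
    _ = _ := by rw [e2]; ring

lemma real_f2 (K δ L α ε : ℝ) (hK : 0 < K) (hδ : 0 < δ) (hxL : K * δ ≤ L) (hε0 : 0 < ε) :
    δ ^ (1 + α / 2) * K ^ ε * √K ≤ δ ^ (1 / 2 + α / 2 - ε) * L ^ (1 / 2 + ε) := by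
  have h2 : (K * δ) ^ (1 / 2 + ε) ≤ L ^ (1 / 2 + ε) := Real.rpow_le_rpow (by positivity) hxL (by linarith)
  refine le_trans (le_of_eq ?_) (mul_le_mul_of_nonneg_left h2 (Real.rpow_nonneg hδ.le _))
  rw [Real.mul_rpow hK.le hδ.le, Real.sqrt_eq_rpow, mul_assoc, ← Real.rpow_add hK, mul_left_comm, ← Real.rpow_add hδ, mul_comm]
  congr 2
  · ring
  · ring

lemma core_est (d : ℕ) (ε : ℝ) (hε : 0 < ε) (hε1 : ε < 1 / 2) (M : ℕ) (hM : 1 ≤ M) : ∃ C : ℝ, 0 < C ∧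
    ∀ (Ω : Type) [m0 : MeasurableSpace Ω] (P : Measure Ω) [IsProbabilityMeasure P]
      (ℱ : ℝ → MeasurableSpace Ω) (B : ℝ → Ω → EE d), IsBrownianMotion P ℱ B → (∀ t, ℱ t ≤ m0) → Monotone ℱ →
      (∀ ω, Continuous (fun r => B r ω)) → Measurable (Function.uncurry B) →
    ∀ (α : ℝ), 0 ≤ α → α ≤ 1 → ∀ (b : EE d → ℝ) (A H : ℝ), Measurable b →
    (∀ x, |b x| ≤ A) → 0 < H → (∀ x y, |b x - b y| ≤ H * ‖x - y‖ ^ α) → ∀ n : ℕ, 1 ≤ n → ∀ s t : ℝ,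
    0 ≤ s → s ≤ t → t ≤ 1 →
    eLpNorm (fun ω => ∫ r in s..t, XX n b B r ω) ((2 * M : ℕ) : ENNReal) P
      ≤ ENNReal.ofReal (C * (H * ((1 / (n:ℝ)) ^ (1 / 2 + α / 2 - ε) * (t - s) ^ (1 / 2 + ε)))) := by
  obtain ⟨C, hC, hmid⟩ := mid_est d ε hε M hM
  have hG := Gl_one d (2 * M)
  refine ⟨2 * Gl d (2 * M) + C, by linarith, ?_⟩
  intro Ω m0 P hP ℱ B hB hle hmono hBc hBm α ha0 ha1 b A H hb hA hH hbH n hn s t hs hst ht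
  have hn0 : (0:ℝ) < n := by exact_mod_cast hn
  have hn' : (0:ℝ) < 1 / n := by positivity
  have hM1 : (1 : ENNReal) ≤ ((2 * M : ℕ) : ENNReal) := by exact_mod_cast (by omega : 1 ≤ 2 * M)
  set G := Gl d (2 * M) with hGdef
  set R := (1 / (n:ℝ)) ^ (1 / 2 + α / 2 - ε) * (t - s) ^ (1 / 2 + ε) with hR
  have hR0 : 0 ≤ R := mul_nonneg (Real.rpow_nonneg hn'.le _) (Real.rpow_nonneg (by linarith) _)
  have short : ∀ u v : ℝ, s ≤ u → u ≤ v → v ≤ t → v - u ≤ 1 / n →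
      eLpNorm (fun ω => ∫ r in u..v, XX n b B r ω) ((2 * M : ℕ) : ENNReal) P ≤ ENNReal.ofReal (G * (H * R)) := by
    intro u v hu huv hv hl
    refine (triv_est hB hle hBm hb hH.le ha0 ha1 hbH n hn M hM u v (hs.trans hu) huv (hv.trans ht)).trans ?_
    apply ENNReal.ofReal_le_ofReal
    refine mul_le_mul_of_nonneg_left ?_ (by linarith)
    have := real_f1 (v - u) (1 / n) (t - s) α ε (by linarith) hn' hl (by linarith) hε hε1
    calc (v - u) * (H * (1 / (n:ℝ)) ^ (α / 2)) = H * ((v - u) * (1 / (n:ℝ)) ^ (α / 2)) := by ring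
      _ ≤ H * R := mul_le_mul_of_nonneg_left this hH.le
  have hHR : 0 ≤ H * R := mul_nonneg hH.le hR0
  have hGHR : 0 ≤ G * (H * R) := mul_nonneg (by linarith) hHR
  have hCHR : 0 ≤ C * (H * R) := mul_nonneg hC.le hHR
  rcases le_total (t - s) (1 / n) with hcase | hcase
  · refine (short s t le_rfl hst le_rfl hcase).trans ?_
    apply ENNReal.ofReal_le_ofReal
    nlinarith
  · set i := ⌈(n:ℝ) * s⌉₊ with hi
    set j := ⌊(n:ℝ) * t⌋₊ with hj
    have hi1 : (n:ℝ) * s ≤ i := Nat.le_ceil _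
    have hi2 : (i:ℝ) < n * s + 1 := Nat.ceil_lt_add_one (by positivity)
    have hj1 : (j:ℝ) ≤ n * t := Nat.floor_le (by nlinarith)
    have hj2 : (n:ℝ) * t < j + 1 := Nat.lt_floor_add_one _
    have hnt : 1 ≤ (n:ℝ) * (t - s) := by
      rw [div_le_iff₀ hn0] at hcase
      linarith
    have hij : i ≤ j := Nat.le_floor (by linarith)
    obtain ⟨K, hK⟩ := Nat.exists_eq_add_of_le hij
    have hnn : (n:ℝ) * (1 / n) = 1 := by field_simp
    set δ := 1 / (n:ℝ) with hδ
    have es : s = (n * s) * δ := by rw [mul_right_comm, hnn, one_mul]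
    have et : t = (n * t) * δ := by rw [mul_right_comm, hnn, one_mul]
    have b1 : s ≤ i * δ := by rw [es]; exact mul_le_mul_of_nonneg_right hi1 hn'.le
    have b2 : i * δ - s ≤ δ := by
      have : (i:ℝ) * δ ≤ (n * s + 1) * δ := mul_le_mul_of_nonneg_right hi2.le hn'.le
      linarith
    have b3 : j * δ ≤ t := by rw [et]; exact mul_le_mul_of_nonneg_right hj1 hn'.le
    have b4 : t - j * δ ≤ δ := by
      have : (n * t) * δ ≤ ((j:ℝ) + 1) * δ := mul_le_mul_of_nonneg_right hj2.le hn'.le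
      linarith
    have b5 : (i:ℝ) * δ ≤ j * δ := mul_le_mul_of_nonneg_right (by exact_mod_cast hij) hn'.le
    have mid : eLpNorm (fun ω => ∫ r in (i * δ)..(j * δ), XX n b B r ω) ((2 * M : ℕ) : ENNReal) P ≤ ENNReal.ofReal (C * (H * R)) := by
      rcases Nat.eq_zero_or_pos K with h0 | h0
      · rw [hK, h0]
        simp
      · have e : (fun ω => ∫ r in (i * δ)..(j * δ), XX n b B r ω) =
            fun ω => ∑ k ∈ Finset.range K, ZZ b B δ ((i + k) * δ) ω := by
          funext ω
          rw [hK]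
          exact mid_eq n hn hb hA hBm i K ω
        rw [e]
        have hjK : ((i:ℝ) + K) = j := by rw [hK]; push_cast; ring
        refine (hmid Ω P ℱ B hB hle hmono hBc hBm α ha0 ha1 b A H hb hA hH hbH δ hn' i K h0 (by rw [hjK]; linarith)).trans ?_
        apply ENNReal.ofReal_le_ofReal
        refine mul_le_mul_of_nonneg_left ?_ hC.le
        have hKL : (K:ℝ) * δ ≤ t - s := by
          have : (K:ℝ) * δ = j * δ - i * δ := by rw [← hjK]; ring
          linarith
        have := real_f2 K δ (t - s) α ε (by exact_mod_cast h0) hn' hKL hε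
        calc H * δ ^ (1 + α / 2) * (K:ℝ) ^ ε * √K = H * (δ ^ (1 + α / 2) * (K:ℝ) ^ ε * √K) := by ring
          _ ≤ H * R := mul_le_mul_of_nonneg_left this hH.le
    have es : (fun ω => ∫ r in s..t, XX n b B r ω) =
        ((fun ω => ∫ r in s..(i * δ), XX n b B r ω) + fun ω => ∫ r in (i * δ)..(j * δ), XX n b B r ω) +
          fun ω => ∫ r in (j * δ)..t, XX n b B r ω := by
      funext ω
      simp only [Pi.add_apply]
      rw [intervalIntegral.integral_add_adjacent_intervals (XX_int n hb hA hBm ω _ _) (XX_int n hb hA hBm ω _ _),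
        intervalIntegral.integral_add_adjacent_intervals (XX_int n hb hA hBm ω _ _) (XX_int n hb hA hBm ω _ _)]
    rw [es]
    have m1 := XXI_meas n hb hBm s (i * δ)
    have m2 := XXI_meas n hb hBm (i * δ) (j * δ)
    have m3 := XXI_meas n hb hBm (j * δ) t
    refine (eLpNorm_add_le (m1.add m2).aestronglyMeasurable m3.aestronglyMeasurable hM1).trans ?_
    refine (add_le_add_left (eLpNorm_add_le m1.aestronglyMeasurable m2.aestronglyMeasurable hM1) _).trans ?_
    refine (add_le_add (add_le_add (short s (i * δ) le_rfl b1 (by linarith) b2) mid) (short (j * δ) t (by linarith) b3 le_rfl b4)).trans ?_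
    rw [← ENNReal.ofReal_add hGHR hCHR, ← ENNReal.ofReal_add (by linarith) hGHR]
    apply ENNReal.ofReal_le_ofReal
    linarith

lemma bm_clamp {Ω : Type} [m0 : MeasurableSpace Ω] {P : Measure Ω} {ℱ : ℝ → MeasurableSpace Ω} {d : ℕ}
    {B : ℝ → Ω → EE d} (hB : IsBrownianMotion P ℱ B) :
    IsBrownianMotion P ℱ (fun r => B (max 0 (min r 1))) := by
  have e : ∀ r : ℝ, 0 ≤ r → r ≤ 1 → max 0 (min r 1) = r := fun r h0 h1 => by rw [min_eq_left h1, max_eq_right h0]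
  refine ⟨?_, ?_, ?_, ?_, ?_⟩
  · intro ω
    refine (hB.contPaths ω).congr fun r hr => ?_
    simp only [e r hr.1 hr.2]
  · intro ω
    simp only [e 0 le_rfl zero_le_one]
    exact hB.init ω
  · intro t h0 h1
    simp only [e t h0 h1]
    exact hB.adapted t h0 h1
  · intro s t h0 h1 h2
    simp only [e s h0 (h1.trans h2), e t (h0.trans h1) h2]
    exact hB.indep s t h0 h1 h2
  · intro s t h0 h1 h2
    simp only [e s h0 (h1.trans h2), e t (h0.trans h1) h2]
    exact hB.law s t h0 h1 h2

lemma bm_clamp_cont {Ω : Type} [m0 : MeasurableSpace Ω] {P : Measure Ω} {ℱ : ℝ → MeasurableSpace Ω} {d : ℕ}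
    {B : ℝ → Ω → EE d} (hB : IsBrownianMotion P ℱ B) (ω : Ω) : Continuous (fun r => B (max 0 (min r 1)) ω) :=
  (hB.contPaths ω).comp_continuous (f := fun r : ℝ => max 0 (min r 1)) (by fun_prop)
    (fun r => ⟨le_max_left _ _, max_le zero_le_one (min_le_right _ _)⟩)

lemma bm_clamp_meas {Ω : Type} [m0 : MeasurableSpace Ω] {P : Measure Ω} {ℱ : ℝ → MeasurableSpace Ω} {d : ℕ}
    {B : ℝ → Ω → EE d} (hB : IsBrownianMotion P ℱ B) (hle : ∀ t, ℱ t ≤ m0) :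
    Measurable (Function.uncurry (fun r => B (max 0 (min r 1)))) :=
  measurable_uncurry_of_continuous_of_measurable (bm_clamp_cont hB) fun r =>
    (hB.adapted _ (le_max_left _ _) (max_le zero_le_one (min_le_right _ _))).mono (hle _) le_rfl

lemma lpNorm_le {Ω : Type} [m0 : MeasurableSpace Ω] {P : Measure Ω} [IsProbabilityMeasure P] (f : Ω → ℝ) (hf : Measurable f)
    (p : ℝ) (hp : 2 ≤ p) (q : ENNReal) (hq : ENNReal.ofReal p ≤ q) (c : ℝ) (hc : 0 ≤ c)
    (h : eLpNorm f q P ≤ ENNReal.ofReal c) : lpNorm P p f ≤ c := by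
  have h1 := (eLpNorm_le_eLpNorm_of_exponent_le hq hf.aestronglyMeasurable).trans h
  have hp0 : ENNReal.ofReal p ≠ 0 := by simp; linarith
  rw [eLpNorm_eq_lintegral_rpow_enorm_toReal hp0 ENNReal.ofReal_ne_top, ENNReal.toReal_ofReal (by linarith)] at h1
  have e : ∫ ω, ‖f ω‖ ^ p ∂P = (∫⁻ ω, ‖f ω‖ₑ ^ p ∂P).toReal := by
    rw [integral_eq_lintegral_of_nonneg_ae (Filter.Eventually.of_forall fun ω => Real.rpow_nonneg (norm_nonneg _) _)
      (hf.norm.pow_const p).aestronglyMeasurable]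
    congr 2
    funext ω
    rw [← ENNReal.ofReal_rpow_of_nonneg (norm_nonneg _) (by linarith), ofReal_norm]
  unfold _root_.lpNorm
  rw [e, ENNReal.toReal_rpow]
  exact ENNReal.toReal_le_of_le_ofReal hc h1

/-- **Quadrature bound for Brownian motion** (Step 1 of Section 3.1).
For `b` bounded measurable of class `C^α`, `α ∈ [0,1]`, `p ≥ 2`, `ε ∈ (0,1/2)`,
`‖∫_s^t (b(B_r) - b(B_{κ_n(r)})) dr‖_{L_p} ≤ N ‖b‖_{C^α} n^{-1/2-α/2+ε} |t-s|^{1/2+ε}`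
with `N = N(p,d,α,ε)`. Here `Cb` is any admissible value of `‖b‖_{C^α}`
(a common bound for `sup|b|` and the `α`-Hölder seminorm; for `α = 0` only
boundedness is required). -/
theorem stmt_4 (d : ℕ) (hd : 1 ≤ d) (α : ℝ) (hα0 : 0 ≤ α) (hα1 : α ≤ 1)
    (p ε : ℝ) (hp : 2 ≤ p) (hε0 : 0 < ε) (hε1 : ε < 1/2) :
    ∃ N : ℝ, 0 < N ∧
      ∀ (Ω : Type) [m0 : MeasurableSpace Ω] (P : Measure Ω), IsProbabilityMeasure P →
      ∀ ℱ : ℝ → MeasurableSpace Ω, Monotone ℱ → (∀ t, ℱ t ≤ m0) →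
      ∀ B : ℝ → Ω → EuclideanSpace ℝ (Fin d), IsBrownianMotion P ℱ B →
      ∀ (b : EuclideanSpace ℝ (Fin d) → ℝ) (Cb : ℝ), Measurable b → 0 ≤ Cb →
      (∀ x, |b x| ≤ Cb) →
      (α ≠ 0 → ∀ x y, |b x - b y| ≤ Cb * ‖x - y‖ ^ α) →
      ∀ n : ℕ, 1 ≤ n → ∀ s t : ℝ, 0 ≤ s → s ≤ t → t ≤ 1 →
        lpNorm P p (fun ω => ∫ r in s..t, (b (B r ω) - b (B (kappa n r) ω)))
          ≤ N * Cb * (n : ℝ) ^ (-(1 : ℝ)/2 - α/2 + ε) * (t - s) ^ ((1 : ℝ)/2 + ε) := by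
  obtain ⟨M, hM⟩ := exists_nat_ge p
  have hM1 : 1 ≤ M := by
    have : (1:ℝ) ≤ M := by linarith
    exact_mod_cast this
  obtain ⟨C, hC, hcore⟩ := core_est d ε hε0 hε1 M hM1
  refine ⟨2 * C, by positivity, ?_⟩
  intro Ω m0 P hP ℱ hmono hle B hB b Cb hb hCb hbd hhol n hn s t hs hst ht
  have hn0 : (0:ℝ) < n := by exact_mod_cast hn
  have hrhs : C * (2 * Cb * ((1 / (n:ℝ)) ^ (1 / 2 + α / 2 - ε) * (t - s) ^ (1 / 2 + ε))) =
      2 * C * Cb * (n : ℝ) ^ (-(1 : ℝ)/2 - α/2 + ε) * (t - s) ^ ((1 : ℝ)/2 + ε) := by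
    have : (1 / (n:ℝ)) ^ (1 / 2 + α / 2 - ε) = (n : ℝ) ^ (-(1 : ℝ)/2 - α/2 + ε) := by
      rw [one_div, Real.inv_rpow hn0.le, ← Real.rpow_neg hn0.le]
      congr 1
      ring
    rw [this]
    ring
  rcases hCb.eq_or_lt with h0 | hpos
  · have hb0 : ∀ x, b x = 0 := fun x => abs_nonpos_iff.1 ((hbd x).trans h0.symm.le)
    simp only [hb0, ← h0]
    unfold _root_.lpNorm
    have : (0:ℝ) < p := by linarith
    simp [Real.zero_rpow this.ne', this.ne']
  · rw [← hrhs]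
    have hbH : ∀ x y, |b x - b y| ≤ 2 * Cb * ‖x - y‖ ^ α := by
      intro x y
      by_cases hα : α = 0
      · rw [hα, Real.rpow_zero, mul_one]
        have := abs_sub (b x) (b y)
        linarith [hbd x, hbd y]
      · refine (hhol hα x y).trans ?_
        have := Real.rpow_nonneg (norm_nonneg (x - y)) α
        nlinarith
    have hBm := bm_clamp_meas hB hle
    have e : (fun ω => ∫ r in s..t, (b (B r ω) - b (B (kappa n r) ω))) =
        fun ω => ∫ r in s..t, XX n b (fun r => B (max 0 (min r 1))) r ω := by
      funext ω
      apply intervalIntegral.integral_congr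
      intro r hr
      rw [uIcc_of_le hst] at hr
      have r0 : 0 ≤ r := hs.trans hr.1
      have r1 : r ≤ 1 := hr.2.trans ht
      have k0 := kappa_nonneg n r r0
      have k1 := (kappa_le n hn r).trans r1
      simp only [XX]
      rw [min_eq_left r1, max_eq_right r0, min_eq_left k1, max_eq_right k0]
    rw [e]
    refine lpNorm_le _ (XXI_meas n hb hBm s t) p hp ((2 * M : ℕ) : ENNReal) ?_ _ ?_
      (hcore Ω P ℱ _ (bm_clamp hB) hle hmono (bm_clamp_cont hB) hBm α hα0 hα1 b Cb (2 * Cb) hb hbd (by linarith) hbH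
        n hn s t hs hst ht)
    · rw [← ENNReal.ofReal_natCast]
      apply ENNReal.ofReal_le_ofReal
      push_cast
      have : (0:ℝ) ≤ M := by positivity
      linarith
    · exact mul_nonneg hC.le (mul_nonneg (by linarith) (mul_nonneg (Real.rpow_nonneg (by positivity) _)
        (Real.rpow_nonneg (by linarith) _)))
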